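/- Let V be a bounded linear operator from a separable Hilbert space ℋ to a separable Hilbert space ℋ'. The function ρ ↦ H(VρV*) is continuous on 𝔖(ℋ) if and only if V is compact and its sequence {ν_i} of singular values (eigenvalues of √(V*V)) satisfies Σ_{i=1}^{∞} e^{−λ/ν_i²} < +∞ for some λ > 0. In that case, sup_{ρ∈𝔖(ℋ)} H(VρV*) = λ*(V), where λ*(V) is the unique solution λ of the equation Σ_{i=1}^{∞} e^{−λ/ν_i²} = 1 if this equation has a solution, and otherwise λ*(V) = g({ν_i^{−2}}) := inf{λ > 0 | Σ_{i=1}^{∞} e^{−λ/ν_i²} < +∞}. -/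

import Mathlib

open scoped ENNReal NNReal
open Filter Topology Classical
attribute [local instance] Classical.propDecidable

noncomputable section

namespace QIT

section Defs

variable {E F G : Type*}
variable [NormedAddCommGroup E] [InnerProductSpace ℂ E] [CompleteSpace E]
variable [NormedAddCommGroup F] [InnerProductSpace ℂ F] [CompleteSpace F]
variable [NormedAddCommGroup G] [InnerProductSpace ℂ G] [CompleteSpace G]

/-- The real part of `⟪x, A x⟫`. -/
def qf (A : E →L[ℂ] E) (x : E) : ℝ := (inner ℂ x (A x) : ℂ).re

/-- The trace of a positive operator, as the supremum of finite diagonal sums over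
finite orthonormal families.  For positive operators this coincides with the usual
trace (with value `∞` when the operator is not trace class). -/
def traceENN (A : E →L[ℂ] E) : ℝ≥0∞ :=
  ⨆ (n : ℕ) (e : Fin n → E) (_ : Orthonormal ℂ e), ∑ i, ENNReal.ofReal (qf A (e i))

/-- The trace norm `‖A‖₁`, as the supremum of `∑ |⟪e i, A (f i)⟫|` over pairs of finite
orthonormal families; it is finite exactly on trace-class operators. -/
def traceNorm (A : E →L[ℂ] E) : ℝ≥0∞ :=
  ⨆ (n : ℕ) (e : Fin n → E) (f : Fin n → E) (_ : Orthonormal ℂ e) (_ : Orthonormal ℂ f),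
    ∑ i, ENNReal.ofReal ‖(inner ℂ (e i) (A (f i)) : ℂ)‖

/-- `A` is a trace-class operator. -/
def IsTC (A : E →L[ℂ] E) : Prop := traceNorm A ≠ ∞

/-- The cone `𝔗₊(E)` of positive trace-class operators. -/
def posTC (E : Type*) [NormedAddCommGroup E] [InnerProductSpace ℂ E] [CompleteSpace E] :
    Set (E →L[ℂ] E) := {A | A.IsPositive ∧ IsTC A}

/-- The set `𝔖(E)` of states (density operators). -/
def states (E : Type*) [NormedAddCommGroup E] [InnerProductSpace ℂ E] [CompleteSpace E] :
    Set (E →L[ℂ] E) := {A | A.IsPositive ∧ traceENN A = 1}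

/-- The extended classical entropy `H({x_i}) = ∑ η(x_i) − η(∑ x_i)` of a nonnegative
summable family, written in the equivalent homogeneous form `(∑ x) · H({x_i/∑x})`. -/
def clEntropy {ι : Type*} (x : ι → ℝ) : ℝ≥0∞ :=
  ENNReal.ofReal (∑' i, x i) *
    ∑' i, ENNReal.ofReal (Real.negMulLog (x i / (∑' j, x j)))

/-- An orthonormal subset with dense span (an orthonormal basis, as a set). -/
def IsONB (s : Set E) : Prop :=
  Orthonormal ℂ ((↑) : s → E) ∧ Dense ((Submodule.span ℂ s : Submodule ℂ E) : Set E)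

/-- The quantum (von Neumann) entropy `H(A) = Tr η(A) − η(Tr A)` of a positive trace-class
operator, realized as the infimum over all orthonormal bases of the classical entropy of
the diagonal of `A` (the infimum is attained on an eigenbasis of `A`). -/
def qEntropy (A : E →L[ℂ] E) : ℝ≥0∞ :=
  ⨅ (s : Set E) (_ : IsONB s), clEntropy fun v : s => qf A v

theorem exists_isONB (E : Type*) [NormedAddCommGroup E] [InnerProductSpace ℂ E]
    [CompleteSpace E] : ∃ s : Set E, IsONB s := by
  obtain ⟨w, b, hb⟩ := exists_hilbertBasis ℂ E
  refine ⟨w, ?_, ?_⟩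
  · have h := b.orthonormal
    rwa [hb] at h
  · have h := b.dense_span
    rw [hb, Subtype.range_coe] at h
    rwa [Submodule.dense_iff_topologicalClosure_eq_top]

/-- A fixed orthonormal basis (as a set). -/
def stdONB (E : Type*) [NormedAddCommGroup E] [InnerProductSpace ℂ E] [CompleteSpace E] :
    Set E := (exists_isONB E).choose

/-- The `ℂ`-valued trace, computed in a fixed orthonormal basis; for trace-class
operators it does not depend on the choice of the basis. -/
def traceC (A : E →L[ℂ] E) : ℂ := ∑' v : stdONB E, (inner ℂ (v : E) (A v) : ℂ)

/-- Continuity (including finiteness) of an `ℝ≥0∞`-valued function on a subset of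
operators, with respect to the trace-norm distance. -/
def ContOn (f : (E →L[ℂ] E) → ℝ≥0∞) (𝒜 : Set (E →L[ℂ] E)) : Prop :=
  (∀ A ∈ 𝒜, f A ≠ ∞) ∧
  ∀ A ∈ 𝒜, ∀ ε : ℝ, 0 < ε → ∃ δ : ℝ, 0 < δ ∧
    ∀ B ∈ 𝒜, traceNorm (B - A) < ENNReal.ofReal δ → |(f B).toReal - (f A).toReal| < ε

/-- Continuity of a real-valued function on a subset of operators with respect to the
trace-norm distance. -/
def RContOn (g : (E →L[ℂ] E) → ℝ) (𝒜 : Set (E →L[ℂ] E)) : Prop :=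
  ∀ A ∈ 𝒜, ∀ ε : ℝ, 0 < ε → ∃ δ : ℝ, 0 < δ ∧
    ∀ B ∈ 𝒜, traceNorm (B - A) < ENNReal.ofReal δ → |g B - g A| < ε

/-- Boundedness of an `ℝ≥0∞`-valued function on a set. -/
def BddOn (f : (E →L[ℂ] E) → ℝ≥0∞) (𝒜 : Set (E →L[ℂ] E)) : Prop :=
  ∃ C : ℝ, ∀ A ∈ 𝒜, f A ≤ ENNReal.ofReal C

/-- Convergence of a sequence of operators in the trace norm. -/
def TendstoTN (A : ℕ → (E →L[ℂ] E)) (A₀ : E →L[ℂ] E) : Prop :=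
  ∀ ε : ℝ, 0 < ε → ∃ N : ℕ, ∀ n ≥ N, traceNorm (A n - A₀) < ENNReal.ofReal ε

/-- A positive linear map from the trace class of `E` to the trace class of `F`
(the values of `toFun` outside the trace class are irrelevant). -/
structure TraceMap (E F : Type*) [NormedAddCommGroup E] [InnerProductSpace ℂ E]
    [CompleteSpace E] [NormedAddCommGroup F] [InnerProductSpace ℂ F] [CompleteSpace F] where
  toFun : (E →L[ℂ] E) → (F →L[ℂ] F)
  map_add : ∀ A B, IsTC A → IsTC B → toFun (A + B) = toFun A + toFun B
  map_smul : ∀ (c : ℂ) A, IsTC A → toFun (c • A) = c • toFun A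
  maps_tc : ∀ A, IsTC A → IsTC (toFun A)
  pos : ∀ A, IsTC A → A.IsPositive → (toFun A).IsPositive

/-- A trace-non-increasing map. -/
def TraceMap.TNI (Φ : TraceMap E F) : Prop :=
  ∀ A, IsTC A → A.IsPositive → traceENN (Φ.toFun A) ≤ traceENN A

/-- A trace-preserving map. -/
def TraceMap.TP (Φ : TraceMap E F) : Prop :=
  ∀ A, IsTC A → A.IsPositive → traceENN (Φ.toFun A) = traceENN A

/-- A map bounded with respect to the trace norm. -/
def TraceMap.Bounded (Φ : TraceMap E F) : Prop :=
  ∃ C : ℝ≥0, ∀ A, traceNorm (Φ.toFun A) ≤ (C : ℝ≥0∞) * traceNorm A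

/-- The output entropy `H_Φ = H ∘ Φ`. -/
def outEntropy (Φ : TraceMap E F) (A : E →L[ℂ] E) : ℝ≥0∞ := qEntropy (Φ.toFun A)

/-- The rank-one operator `|x⟩⟨x|`. -/
def rankOne (x : E) : E →L[ℂ] E := (innerSL ℂ x).smulRight x

/-- The rank-one operator `|x⟩⟨y|`. -/
def rankOneM (x y : E) : E →L[ℂ] E := (innerSL ℂ y).smulRight x

end Defs

section Defs2

variable {E F G : Type*}
variable [NormedAddCommGroup E] [InnerProductSpace ℂ E] [CompleteSpace E]
variable [NormedAddCommGroup F] [InnerProductSpace ℂ F] [CompleteSpace F]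
variable [NormedAddCommGroup G] [InnerProductSpace ℂ G] [CompleteSpace G]

/-- The completely positive map `A ↦ ∑ᵢ Vᵢ A Vᵢ*` defined by a sequence of Kraus
operators. -/
def krausMap (V : ℕ → (E →L[ℂ] F)) (A : E →L[ℂ] E) : F →L[ℂ] F :=
  ∑' i, V i ∘L A ∘L ContinuousLinearMap.adjoint (V i)

/-- The Kraus condition `∑ᵢ Vᵢ* Vᵢ ≤ I` (all partial sums are dominated by `I`). -/
def KrausTNI (V : ℕ → (E →L[ℂ] F)) : Prop :=
  ∀ n : ℕ,
    ((1 : E →L[ℂ] E) - ∑ i ∈ Finset.range n, ContinuousLinearMap.adjoint (V i) ∘L V i).IsPositive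

/-- The Kraus condition `∑ᵢ Vᵢ* Vᵢ = I` (strong convergence), i.e. trace preservation. -/
def KrausTP (V : ℕ → (E →L[ℂ] F)) : Prop :=
  ∀ x : E, HasSum (fun i => (ContinuousLinearMap.adjoint (V i)) (V i x)) x

/-- `(Φ, Φt)` is a complementary pair of quantum operations: for some Kraus
representation `Φ(·) = ∑ᵢ Vᵢ (·) Vᵢ*` and some orthonormal basis `{bᵢ}` of `G`,
`Φt(A) = ∑_{i,j} Tr[Vᵢ A Vⱼ*] |bᵢ⟩⟨bⱼ|` (characterized by its matrix entries). -/
def IsComplementaryPair (Φ : TraceMap E F) (Φt : TraceMap E G) : Prop :=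
  ∃ (V : ℕ → (E →L[ℂ] F)) (b : HilbertBasis ℕ ℂ G),
    KrausTNI V ∧
    (∀ A, IsTC A → Φ.toFun A = krausMap V A) ∧
    (∀ A, IsTC A → ∀ i j : ℕ,
      (inner ℂ (b i) (Φt.toFun A (b j)) : ℂ) =
        traceC (V i ∘L A ∘L ContinuousLinearMap.adjoint (V j)))

/-- A map (on trace-class operators) preserves continuity of the entropy:
its output entropy is continuous on every subset of the positive trace-class cone on
which the von Neumann entropy is continuous. -/
def PCE (Φf : (E →L[ℂ] E) → (F →L[ℂ] F)) : Prop :=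
  ∀ 𝒜 : Set (E →L[ℂ] E), 𝒜 ⊆ posTC E → ContOn qEntropy 𝒜 →
    ContOn (fun A => qEntropy (Φf A)) 𝒜

/-- `μ` is the sequence of nonzero eigenvalues (with multiplicities, possibly padded by
zeros) of the diagonalizable positive operator `T`, every vector orthogonal to the
eigenvectors being annihilated by `T`. -/
def IsEigenSeq (T : E →L[ℂ] E) (μ : ℕ → ℝ) : Prop :=
  ∃ e : ℕ → E,
    (∀ i j, i ≠ j → (inner ℂ (e i) (e j) : ℂ) = 0) ∧
    (∀ i, (μ i ≠ 0 → ‖e i‖ = 1) ∧ (μ i = 0 → e i = 0)) ∧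
    (∀ i, T (e i) = (μ i : ℂ) • e i) ∧
    (∀ x : E, (∀ i, (inner ℂ (e i) x : ℂ) = 0) → T x = 0)

/-- `ν` is the sequence of singular values of `V` (eigenvalues of `√(V*V)`,
equivalently `ν²` are the eigenvalues of `V*V`). -/
def IsSingularValues (V : E →L[ℂ] F) (ν : ℕ → ℝ) : Prop :=
  (∀ i, 0 ≤ ν i) ∧ IsEigenSeq (ContinuousLinearMap.adjoint V ∘L V) (fun i => ν i ^ 2)

/-- `∑ᵢ e^{−l/νᵢ²}`, the sum being taken over the indices with `νᵢ ≠ 0`. -/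
def expSum (ν : ℕ → ℝ) (l : ℝ) : ℝ≥0∞ :=
  ∑' i, if ν i = 0 then 0 else ENNReal.ofReal (Real.exp (-(l / ν i ^ 2)))

/-- `λ*(V) < ∞`: `V` is compact (automatic here) and `∑ᵢ e^{−l/νᵢ²} < ∞` for some
`l > 0`, where `{νᵢ}` are the singular values of `V`. -/
def LamStarFin (V : E →L[ℂ] F) : Prop :=
  ∃ ν : ℕ → ℝ, IsSingularValues V ν ∧ ∃ l : ℝ, 0 < l ∧ expSum ν l ≠ ∞

/-- `λ*(√S) < ∞` for a positive operator `S` (the singular values of `√S` are the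
square roots of the eigenvalues of `S`). -/
def LamStarSqrtFin (S : E →L[ℂ] E) : Prop :=
  ∃ ν : ℕ → ℝ, (∀ i, 0 ≤ ν i) ∧ IsEigenSeq S (fun i => ν i ^ 2) ∧
    ∃ l : ℝ, 0 < l ∧ expSum ν l ≠ ∞

/-- The value `λ*` associated to a sequence `ν` of singular values: the unique solution
of `∑ᵢ e^{−λ/νᵢ²} = 1` if it exists, and `inf{λ > 0 | ∑ᵢ e^{−λ/νᵢ²} < ∞}` otherwise. -/
def lamStarOf (ν : ℕ → ℝ) : ℝ≥0∞ :=
  if h : ∃ l : ℝ, expSum ν l = 1 then ENNReal.ofReal h.choose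
  else ⨅ (l : ℝ) (_ : 0 < l ∧ expSum ν l ≠ ∞), ENNReal.ofReal l

/-- The parameter `λ*(V) ∈ [0,∞]` of a bounded operator `V`. -/
def lamStar (V : E →L[ℂ] F) : ℝ≥0∞ :=
  if h : ∃ ν : ℕ → ℝ, IsSingularValues V ν then lamStarOf h.choose else ∞

/-- `rank A ≤ k`. -/
def rankLE (A : E →L[ℂ] E) (k : ℕ) : Prop :=
  Module.rank ℂ (LinearMap.range (A : E →ₗ[ℂ] E)) ≤ k

/-- The set `𝔗₊ᵏ(E)` of positive (trace-class) operators of rank at most `k`. -/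
def rankCone (E : Type*) [NormedAddCommGroup E] [InnerProductSpace ℂ E] [CompleteSpace E]
    (k : ℕ) : Set (E →L[ℂ] E) := {A | A.IsPositive ∧ rankLE A k}

/-- A decomposition of `A` into a countable convex combination of positive operators of
rank at most `k`. -/
structure Decomp (k : ℕ) (A : E →L[ℂ] E) where
  π : ℕ → ℝ
  op : ℕ → (E →L[ℂ] E)
  π_nonneg : ∀ i, 0 ≤ π i
  π_sum : HasSum π 1
  op_pos : ∀ i, (op i).IsPositive
  op_rank : ∀ i, rankLE (op i) k
  sum_eq : HasSum (fun i => π i • op i) A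

/-- The `k`-order approximator `H_Φᵏ` of the output entropy of `Φ`. -/
def kApprox (Φf : (E →L[ℂ] E) → (F →L[ℂ] F)) (k : ℕ) (A : E →L[ℂ] E) : ℝ≥0∞ :=
  ⨆ d : Decomp k A, ∑' i, ENNReal.ofReal (d.π i) * qEntropy (Φf (d.op i))

/-- The set of pure states (extreme points of `𝔖(E)`). -/
def pureStates (E : Type*) [NormedAddCommGroup E] [InnerProductSpace ℂ E]
    [CompleteSpace E] : Set (E →L[ℂ] E) := {A | ∃ x : E, ‖x‖ = 1 ∧ A = rankOne x}

end Defs2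

section Tensor

variable (E F G : Type*)
variable [NormedAddCommGroup E] [InnerProductSpace ℂ E] [CompleteSpace E]
variable [NormedAddCommGroup F] [InnerProductSpace ℂ F] [CompleteSpace F]
variable [NormedAddCommGroup G] [InnerProductSpace ℂ G] [CompleteSpace G]

/-- A realization of `G` as the Hilbert tensor product `E ⊗ F`, together with the
tensor product of (bounded) operators. -/
structure TensorData where
  tmul : E → F → G
  add_left : ∀ x y z, tmul (x + y) z = tmul x z + tmul y z
  add_right : ∀ x y z, tmul x (y + z) = tmul x y + tmul x z
  smul_left : ∀ (c : ℂ) x y, tmul (c • x) y = c • tmul x y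
  smul_right : ∀ (c : ℂ) x y, tmul x (c • y) = c • tmul x y
  inner_tmul : ∀ x x' y y',
    (inner ℂ (tmul x y) (tmul x' y') : ℂ) = (inner ℂ x x' : ℂ) * (inner ℂ y y' : ℂ)
  dense_span : Dense ((Submodule.span ℂ {z | ∃ x y, z = tmul x y} : Submodule ℂ G) : Set G)
  omul : (E →L[ℂ] E) → (F →L[ℂ] F) → (G →L[ℂ] G)
  omul_tmul : ∀ A B x y, omul A B (tmul x y) = tmul (A x) (B y)

end Tensor

/-! ### Classical entropy -/

/-- The contribution of an entry `x` to the entropy of a family with total mass `X`. -/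
def entTerm (X x : ℝ) : ℝ := x * Real.log (X / x)

@[simp] theorem entTerm_zero (X : ℝ) : entTerm X 0 = 0 := by simp [entTerm]

theorem entTerm_nonneg {X x : ℝ} (hx : 0 ≤ x) (hX : x ≤ X) : 0 ≤ entTerm X x := by
  rcases hx.eq_or_lt with rfl | hx
  · simp
  · exact mul_nonneg hx.le (Real.log_nonneg ((one_le_div hx).2 hX))

/-- The tangent-line bound for the concave function `x ↦ x log (X / x)`. -/
theorem entTerm_le {X x c : ℝ} (hx : 0 ≤ x) (hX : x ≤ X) (hc : 0 < c) :
    entTerm X x ≤ x * Real.log c + X / c - x := by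
  rcases hx.eq_or_lt with rfl | hx
  · simpa using div_nonneg hX hc.le
  · have hXp : 0 < X := hx.trans_le hX
    have h1 : Real.log (X / x) - Real.log c ≤ X / x / c - 1 := by
      rw [← Real.log_div (by positivity) hc.ne']
      exact Real.log_le_sub_one_of_pos (by positivity)
    have h2 := mul_le_mul_of_nonneg_left h1 hx.le
    have h3 : x * (X / x / c - 1) = X / c - x := by field_simp
    unfold entTerm
    nlinarith

/-- The log-sum inequality for two terms. -/
theorem entTerm_add_le {X Y x y : ℝ} (hx : 0 ≤ x) (hX : x ≤ X) (hy : 0 ≤ y) (hY : y ≤ Y) :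
    entTerm X x + entTerm Y y ≤ entTerm (X + Y) (x + y) := by
  rcases (add_nonneg hx hy).eq_or_lt with h | h
  · have hx0 : x = 0 := by linarith
    have hy0 : y = 0 := by linarith
    simp [hx0, hy0]
  · have hc : 0 < (X + Y) / (x + y) := div_pos (by linarith) h
    have h1 := entTerm_le hx hX hc
    have h2 := entTerm_le hy hY hc
    have hXY : 0 < X + Y := by linarith
    have h3 : X / ((X + Y) / (x + y)) + Y / ((X + Y) / (x + y)) = x + y := by
      field_simp
    have h4 : entTerm (X + Y) (x + y) = (x + y) * Real.log ((X + Y) / (x + y)) := rfl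
    rw [h4]
    linarith

section Classical

variable {ι κ : Type*}

theorem clEntropy_eq {x : ι → ℝ} (hx : ∀ i, 0 ≤ x i) :
    clEntropy x = ∑' i, ENNReal.ofReal (entTerm (∑' j, x j) (x i)) := by
  rw [clEntropy, ← ENNReal.tsum_mul_left]
  refine tsum_congr fun i => ?_
  rw [← ENNReal.ofReal_mul (tsum_nonneg hx)]
  congr 1
  rcases eq_or_ne (∑' j, x j) 0 with h | h
  · simp [h, entTerm]
  · rw [entTerm, Real.negMulLog, ← inv_div (x i), Real.log_inv]
    field_simp

theorem clEntropy_add_le {x y : ι → ℝ} (hx : ∀ i, 0 ≤ x i) (hy : ∀ i, 0 ≤ y i)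
    (hxs : Summable x) (hys : Summable y) :
    clEntropy x + clEntropy y ≤ clEntropy (fun i => x i + y i) := by
  rw [clEntropy_eq hx, clEntropy_eq hy, clEntropy_eq fun i => add_nonneg (hx i) (hy i),
    ← ENNReal.tsum_add, hxs.tsum_add hys]
  refine ENNReal.tsum_le_tsum fun i => ?_
  have hxi := hxs.le_tsum i fun j _ => hx j
  have hyi := hys.le_tsum i fun j _ => hy j
  rw [← ENNReal.ofReal_add (entTerm_nonneg (hx i) hxi) (entTerm_nonneg (hy i) hyi)]
  exact ENNReal.ofReal_le_ofReal (entTerm_add_le (hx i) hxi (hy i) hyi)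

theorem clEntropy_mono {x y : ι → ℝ} (hx : ∀ i, 0 ≤ x i) (hxy : ∀ i, x i ≤ y i)
    (hys : Summable y) : clEntropy x ≤ clEntropy y := by
  have hxs : Summable x := hys.of_nonneg_of_le hx hxy
  have h := clEntropy_add_le (y := fun i => y i - x i) hx (fun i => sub_nonneg.2 (hxy i)) hxs
    (hys.sub hxs)
  simp only [add_sub_cancel] at h
  exact le_self_add.trans h

theorem clEntropy_const_mul {c : ℝ} (hc : 0 ≤ c) (x : ι → ℝ) :
    clEntropy (fun i => c * x i) = ENNReal.ofReal c * clEntropy x := by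
  rcases hc.eq_or_lt with rfl | hc
  · simp [clEntropy]
  · simp only [clEntropy, tsum_mul_left]
    rw [ENNReal.ofReal_mul hc.le, mul_assoc]
    simp only [mul_div_mul_left _ _ hc.ne']

/-- Zero entries do not contribute to the entropy. -/
theorem clEntropy_comp_of_injective {x : ι → ℝ} {g : κ → ι} (hg : Function.Injective g)
    (hx : ∀ i, i ∉ Set.range g → x i = 0) : clEntropy (fun k => x (g k)) = clEntropy x := by
  have h1 : ∑' k, x (g k) = ∑' i, x i := hg.tsum_eq fun i hi => by
    by_contra h; exact hi (hx i h)
  unfold clEntropy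
  rw [h1]
  congr 1
  refine hg.tsum_eq (f := fun i => ENNReal.ofReal (Real.negMulLog (x i / ∑' j, x j)))
    fun i hi => ?_
  by_contra h
  exact hi (by simp [hx i h])

theorem clEntropy_fintype [Fintype ι] {x : ι → ℝ} (hx : ∀ i, 0 ≤ x i) :
    clEntropy x = ENNReal.ofReal (∑ i, Real.negMulLog (x i) - Real.negMulLog (∑ i, x i)) := by
  have hle : ∀ i, x i ≤ ∑ j, x j := fun i =>
    Finset.single_le_sum (fun j _ => hx j) (Finset.mem_univ i)
  rw [clEntropy_eq hx, tsum_fintype, tsum_fintype,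
    ← ENNReal.ofReal_sum_of_nonneg fun i _ => entTerm_nonneg (hx i) (hle i)]
  congr 1
  have : ∀ i, entTerm (∑ j, x j) (x i) = Real.negMulLog (x i) + x i * Real.log (∑ j, x j) := by
    intro i
    rcases (hx i).eq_or_lt with h | h
    · simp [← h]
    · rw [entTerm, Real.log_div (h.trans_le (hle i)).ne' h.ne', Real.negMulLog]
      ring
  simp only [this, Finset.sum_add_distrib, ← Finset.sum_mul, Real.negMulLog]
  ring

/-- The Gibbs bound: the entropy is dominated by the mean energy plus the log-partition
function. -/
theorem clEntropy_le_gibbs {x h : ι → ℝ} (hx : ∀ i, 0 ≤ x i) (hxs : Summable x)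
    (hxh : Summable fun i => x i * h i) {l Z : ℝ} (hZ : 0 < Z)
    (hsum : ∑' i, ENNReal.ofReal (Real.exp (-(l * h i))) ≤ ENNReal.ofReal Z) :
    clEntropy x ≤ ENNReal.ofReal (l * (∑' i, x i * h i) + (∑' i, x i) * Real.log Z) := by
  have hes : Summable fun i => Real.exp (-(l * h i)) := by
    have := ENNReal.summable_toReal (hsum.trans_lt ENNReal.ofReal_lt_top).ne
    simpa [ENNReal.toReal_ofReal (Real.exp_pos _).le] using this
  have heZ : ∑' i, Real.exp (-(l * h i)) ≤ Z := by
    rw [← ENNReal.ofReal_tsum_of_nonneg (fun i => (Real.exp_pos _).le) hes] at hsum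
    exact (ENNReal.ofReal_le_ofReal_iff hZ.le).1 hsum
  have hX : 0 ≤ ∑' i, x i := tsum_nonneg hx
  have hpt : ∀ i, entTerm (∑' j, x j) (x i) ≤
      l * (x i * h i) + x i * Real.log Z + (∑' j, x j) / Z * Real.exp (-(l * h i)) - x i := by
    intro i
    have h1 := entTerm_le (hx i) (hxs.le_tsum i fun j _ => hx j)
      (c := Z * Real.exp (l * h i)) (by positivity)
    rw [Real.log_mul hZ.ne' (Real.exp_pos _).ne', Real.log_exp] at h1
    have h2 : (∑' j, x j) / (Z * Real.exp (l * h i)) =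
        (∑' j, x j) / Z * Real.exp (-(l * h i)) := by
      rw [Real.exp_neg]; field_simp
    rw [h2] at h1
    linarith
  have hS1 := (hxh.mul_left l).add (hxs.mul_right (Real.log Z))
  have hS2 := hS1.add (hes.mul_left ((∑' j, x j) / Z))
  have hS := hS2.sub hxs
  have hnn := fun i => (entTerm_nonneg (hx i) (hxs.le_tsum i fun j _ => hx j)).trans (hpt i)
  rw [clEntropy_eq hx]
  refine (ENNReal.tsum_le_tsum fun i => ENNReal.ofReal_le_ofReal (hpt i)).trans ?_
  rw [← ENNReal.ofReal_tsum_of_nonneg hnn hS]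
  refine ENNReal.ofReal_le_ofReal ?_
  rw [hS2.tsum_sub hxs, hS1.tsum_add (hes.mul_left _),
    (hxh.mul_left l).tsum_add (hxs.mul_right _), tsum_mul_left, tsum_mul_right, tsum_mul_left]
  have : (∑' j, x j) / Z * ∑' i, Real.exp (-(l * h i)) ≤ ∑' j, x j := by
    calc _ ≤ (∑' j, x j) / Z * Z := mul_le_mul_of_nonneg_left heZ (by positivity)
      _ = _ := by field_simp
  linarith

/-- Almost additivity of the entropy under splitting of the index set. -/
theorem clEntropy_le_split {x : ι → ℝ} (hx : ∀ i, 0 ≤ x i) (hxs : Summable x) (J : Set ι)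
    {C : ℝ} (hC : ∑' i, x i ≤ C) :
    clEntropy x ≤ clEntropy (J.indicator x) + clEntropy (Jᶜ.indicator x) +
      ENNReal.ofReal ((∑' i, Jᶜ.indicator x i) + ((∑' i, Jᶜ.indicator x i) * Real.log C +
        Real.negMulLog (∑' i, Jᶜ.indicator x i))) := by
  set y := J.indicator x with hy
  set z := Jᶜ.indicator x with hz
  have hy0 : ∀ i, 0 ≤ y i := fun i => Set.indicator_nonneg (fun i _ => hx i) i
  have hz0 : ∀ i, 0 ≤ z i := fun i => Set.indicator_nonneg (fun i _ => hx i) i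
  have hys : Summable y := hxs.indicator J
  have hzs : Summable z := hxs.indicator Jᶜ
  have hyz : ∀ i, y i + z i = x i := fun i =>
    congrFun (Set.indicator_self_add_compl J x) i
  have hT : ∑' i, x i = ∑' i, y i + ∑' i, z i := by
    rw [← hys.tsum_add hzs]; exact tsum_congr fun i => (hyz i).symm
  set Y := ∑' i, y i
  set X := ∑' i, z i
  have hY : 0 ≤ Y := tsum_nonneg hy0
  have hX : 0 ≤ X := tsum_nonneg hz0
  have hyY : ∀ i, y i ≤ Y := fun i => hys.le_tsum i fun j _ => hy0 j
  have hzX : ∀ i, z i ≤ X := fun i => hzs.le_tsum i fun j _ => hz0 j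
  have key : ∀ {a A : ℝ}, 0 ≤ a → a ≤ A → A ≤ Y + X →
      entTerm (Y + X) a = entTerm A a + a * Real.log ((Y + X) / A) := by
    intro a A ha haA hA
    rcases ha.eq_or_lt with rfl | ha
    · simp
    · have hA0 : 0 < A := ha.trans_le haA
      have hT0 : 0 < Y + X := hA0.trans_le hA
      rw [entTerm, entTerm, Real.log_div hT0.ne' ha.ne', Real.log_div hA0.ne' ha.ne',
        Real.log_div hT0.ne' hA0.ne']
      ring
  have hlog : ∀ {A : ℝ}, 0 ≤ A → A ≤ Y + X → 0 ≤ Real.log ((Y + X) / A) := by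
    intro A hA hAT
    rcases hA.eq_or_lt with rfl | hA
    · simp
    · exact Real.log_nonneg ((one_le_div hA).2 hAT)
  have hterm : ∀ i, ENNReal.ofReal (entTerm (Y + X) (x i)) ≤
      (ENNReal.ofReal (entTerm Y (y i)) + ENNReal.ofReal (entTerm X (z i))) +
        (ENNReal.ofReal (y i * Real.log ((Y + X) / Y)) +
          ENNReal.ofReal (z i * Real.log ((Y + X) / X))) := by
    intro i
    by_cases hi : i ∈ J
    · have h1 : z i = 0 := by simp [hz, hi]
      have h2 : x i = y i := by rw [← hyz i, h1, add_zero]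
      rw [h2, key (hy0 i) (hyY i) (by linarith), h1]
      simp [ENNReal.ofReal_add (entTerm_nonneg (hy0 i) (hyY i))
        (mul_nonneg (hy0 i) (hlog hY (by linarith)))]
    · have h1 : y i = 0 := by simp [hy, hi]
      have h2 : x i = z i := by rw [← hyz i, h1, zero_add]
      rw [h2, key (hz0 i) (hzX i) (by linarith), h1]
      simp [ENNReal.ofReal_add (entTerm_nonneg (hz0 i) (hzX i))
        (mul_nonneg (hz0 i) (hlog hX (by linarith)))]
  rw [clEntropy_eq hx, clEntropy_eq hy0, clEntropy_eq hz0, hT]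
  refine (ENNReal.tsum_le_tsum hterm).trans ?_
  rw [ENNReal.tsum_add, ENNReal.tsum_add, ENNReal.tsum_add]
  gcongr
  rw [← ENNReal.ofReal_tsum_of_nonneg
      (fun i => mul_nonneg (hy0 i) (hlog hY (by linarith))) (hys.mul_right _),
    ← ENNReal.ofReal_tsum_of_nonneg
      (fun i => mul_nonneg (hz0 i) (hlog hX (by linarith))) (hzs.mul_right _),
    tsum_mul_right, tsum_mul_right,
    ← ENNReal.ofReal_add (mul_nonneg hY (hlog hY (by linarith)))
      (mul_nonneg hX (hlog hX (by linarith)))]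
  refine ENNReal.ofReal_le_ofReal (add_le_add ?_ ?_)
  · rcases hY.eq_or_lt with h | h
    · simpa [X, ← h] using hX
    · calc Y * Real.log ((Y + X) / Y) ≤ Y * ((Y + X) / Y - 1) :=
            mul_le_mul_of_nonneg_left (Real.log_le_sub_one_of_pos (by positivity)) h.le
        _ = X := by field_simp; ring
  · rcases hX.eq_or_lt with h | h
    · simp [X, ← h]
    · have h1 : Real.log (Y + X) ≤ Real.log C := Real.log_le_log (by linarith) (hT ▸ hC)
      have : X * Real.log ((Y + X) / X) = X * Real.log (Y + X) + Real.negMulLog X := by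
        rw [Real.log_div (by linarith) h.ne', Real.negMulLog]; ring
      rw [this]
      gcongr

/-- Doubly substochastic averaging does not decrease the entropy. -/
theorem clEntropy_le_of_substochastic [Fintype ι] {W : κ → ι → ℝ} {x : ι → ℝ}
    (hW : ∀ v i, 0 ≤ W v i) (hsum : ∀ i, HasSum (fun v => W v i) (x i))
    (hrow : ∀ v, ∑ i, W v i / x i ≤ 1) :
    clEntropy x ≤ clEntropy fun v => ∑ i, W v i := by
  have hx : ∀ i, 0 ≤ x i := fun i => (hsum i).nonneg fun v => hW v i
  have hWx : ∀ v i, W v i ≤ x i := fun v i => le_hasSum (hsum i) v fun w _ => hW w i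
  have hb : HasSum (fun v => ∑ i, W v i) (∑ i, x i) := hasSum_sum fun i _ => hsum i
  have hxX : ∀ i, x i ≤ ∑ j, x j := fun i =>
    Finset.single_le_sum (fun j _ => hx j) (Finset.mem_univ i)
  set X := ∑ i, x i with hXdef
  have hlog : ∀ i, 0 ≤ Real.log (X / x i) := by
    intro i
    rcases (hx i).eq_or_lt with h | h
    · simp [← h]
    · exact Real.log_nonneg ((one_le_div h).2 (hxX i))
  have hb0 : ∀ v, 0 ≤ ∑ i, W v i := fun v => Finset.sum_nonneg fun i _ => hW v i
  rw [clEntropy_eq hx, clEntropy_eq hb0, hb.tsum_eq, tsum_fintype, tsum_fintype, ← hXdef]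
  have hi : ∀ i, ENNReal.ofReal (entTerm X (x i)) =
      ∑' v, ENNReal.ofReal (W v i * Real.log (X / x i)) := by
    intro i
    have h := (hsum i).mul_right (Real.log (X / x i))
    rw [← ENNReal.ofReal_tsum_of_nonneg (fun v => mul_nonneg (hW v i) (hlog i)) h.summable,
      h.tsum_eq, entTerm]
  simp only [hi]
  rw [← Summable.tsum_finsetSum fun i _ => ENNReal.summable]
  refine ENNReal.tsum_le_tsum fun v => ?_
  rw [← ENNReal.ofReal_sum_of_nonneg fun i _ => mul_nonneg (hW v i) (hlog i)]
  refine ENNReal.ofReal_le_ofReal ?_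
  have hbX : ∑ i, W v i ≤ X := Finset.sum_le_sum fun i _ => hWx v i
  set b := ∑ i, W v i with hbdef
  rcases (hb0 v).eq_or_lt with h | h
  · have : ∀ i, W v i = 0 := fun i =>
      (Finset.sum_eq_zero_iff_of_nonneg fun i _ => hW v i).1 h.symm i (Finset.mem_univ i)
    rw [show b = 0 from h.symm]
    simp [this]
  · have hXp : 0 < X := h.trans_le hbX
    have hpt : ∀ i, W v i * Real.log (X / x i) ≤
        W v i * Real.log (X / b) + W v i / x i * b - W v i := by
      intro i
      rcases (hx i).eq_or_lt with h0 | h0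
      · have : W v i = 0 := le_antisymm (h0 ▸ hWx v i) (hW v i)
        simp [this]
      · have h1 := entTerm_le (hx i) (hxX i) (c := X / b) (by positivity)
        have h2 := mul_le_mul_of_nonneg_left h1 (div_nonneg (hW v i) (hx i))
        have h3 : X / (X / b) = b := by field_simp
        rw [h3] at h2
        calc _ = W v i / x i * entTerm X (x i) := by rw [entTerm]; field_simp
          _ ≤ _ := h2
          _ = _ := by field_simp
    calc _ ≤ ∑ i, (W v i * Real.log (X / b) + W v i / x i * b - W v i) :=
          Finset.sum_le_sum fun i _ => hpt i
      _ = b * Real.log (X / b) + (∑ i, W v i / x i) * b - b := by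
          rw [Finset.sum_sub_distrib, Finset.sum_add_distrib, ← Finset.sum_mul, ← Finset.sum_mul]
      _ ≤ b * Real.log (X / b) := by
          have := mul_le_mul_of_nonneg_right (hrow v) h.le
          linarith
      _ = entTerm X b := rfl

end Classical

/-! ### Orthonormal bases, traces and the entropy of positive operators -/

section Operators

set_option linter.unusedSectionVars false

open ContinuousLinearMap (adjoint)

variable {E F ι : Type*}
variable [NormedAddCommGroup E] [InnerProductSpace ℂ E] [CompleteSpace E]
variable [NormedAddCommGroup F] [InnerProductSpace ℂ F] [CompleteSpace F]

/-- Parseval's identity. -/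
theorem IsONB.hasSum_norm_inner_sq {s : Set E} (hs : IsONB s) (u : E) :
    HasSum (fun v : s => ‖(inner ℂ (v : E) u : ℂ)‖ ^ 2) (‖u‖ ^ 2) := by
  let b := HilbertBasis.mk hs.1 (by
    rw [Subtype.range_coe]
    exact (Submodule.dense_iff_topologicalClosure_eq_top.1 hs.2).ge)
  have hb : ∀ v : s, b v = (v : E) := fun v => by simp [b]
  have h := (b.hasSum_inner_mul_inner u u).mapL Complex.reCLM
  simp only [hb] at h
  convert h using 1
  · ext v
    rw [← inner_conj_symm u, Complex.reCLM_apply, ← Complex.normSq_eq_conj_mul_self,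
      Complex.ofReal_re, Complex.normSq_eq_norm_sq]
  · exact (inner_self_eq_norm_sq (𝕜 := ℂ) u).symm

theorem IsONB.tsum_ofReal_norm_inner_sq {s : Set E} (hs : IsONB s) (u : E) :
    ∑' v : s, ENNReal.ofReal (‖(inner ℂ (v : E) u : ℂ)‖ ^ 2) = ENNReal.ofReal (‖u‖ ^ 2) := by
  have h := hs.hasSum_norm_inner_sq u
  rw [← ENNReal.ofReal_tsum_of_nonneg (fun _ => by positivity) h.summable, h.tsum_eq]

/-- An orthonormal family extends to an orthonormal basis. -/
theorem exists_isONB_of_orthonormal {f : ι → E} (hf : Orthonormal ℂ f) :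
    ∃ s : Set E, IsONB s ∧ Set.range f ⊆ s := by
  obtain ⟨w, b, hsw, hb⟩ := hf.toSubtypeRange.exists_hilbertBasis_extension
  refine ⟨w, ⟨?_, ?_⟩, hsw⟩
  · have h := b.orthonormal
    rwa [hb] at h
  · have h := b.dense_span
    rw [hb, Subtype.range_coe] at h
    rwa [Submodule.dense_iff_topologicalClosure_eq_top]

/-- The Hilbert–Schmidt norms of an operator and of its adjoint coincide. -/
theorem tsum_norm_sq_adjoint (X : E →L[ℂ] F) {s : Set E} {t : Set F} (hs : IsONB s)
    (ht : IsONB t) :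
    ∑' w : t, ENNReal.ofReal (‖adjoint X (w : F)‖ ^ 2) =
      ∑' v : s, ENNReal.ofReal (‖X (v : E)‖ ^ 2) := by
  simp only [← hs.tsum_ofReal_norm_inner_sq, ← ht.tsum_ofReal_norm_inner_sq]
  rw [ENNReal.tsum_comm]
  refine tsum_congr fun v => tsum_congr fun w => ?_
  rw [ContinuousLinearMap.adjoint_inner_right, norm_inner_symm]

theorem qf_adjoint_comp_self (R : E →L[ℂ] F) (x : E) : qf (adjoint R ∘L R) x = ‖R x‖ ^ 2 := by
  rw [qf, ContinuousLinearMap.comp_apply, ContinuousLinearMap.adjoint_inner_right]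
  exact inner_self_eq_norm_sq (𝕜 := ℂ) _

theorem qf_nonneg {A : E →L[ℂ] E} (hA : A.IsPositive) (x : E) : 0 ≤ qf A x :=
  hA.re_inner_nonneg_right x

theorem qf_conj (V : E →L[ℂ] F) (A : E →L[ℂ] E) (x : F) :
    qf (V ∘L A ∘L adjoint V) x = qf A (adjoint V x) := by
  rw [qf, qf, ContinuousLinearMap.comp_apply, ContinuousLinearMap.comp_apply,
    ContinuousLinearMap.adjoint_inner_left]

theorem qf_sub (A B : E →L[ℂ] E) (x : E) : qf (A - B) x = qf A x - qf B x := by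
  simp [qf]

theorem qf_real_smul (c : ℝ) (A : E →L[ℂ] E) (x : E) : qf (c • A) x = c * qf A x := by
  simp [qf, inner_smul_right_eq_smul]

theorem qf_smul_apply (A : E →L[ℂ] E) (c : ℂ) (x : E) : qf A (c • x) = ‖c‖ ^ 2 * qf A x := by
  rw [qf, qf, map_smul, inner_smul_left, inner_smul_right, ← mul_assoc, mul_comm _ c,
    Complex.mul_conj, Complex.re_ofReal_mul, Complex.normSq_eq_norm_sq]

theorem exists_eq_adjoint_comp_self {A : E →L[ℂ] E} (hA : A.IsPositive) :
    ∃ R : E →L[ℂ] E, A = adjoint R ∘L R := by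
  obtain ⟨R, hR⟩ := CStarAlgebra.nonneg_iff_eq_star_mul_self.1
    ((ContinuousLinearMap.nonneg_iff_isPositive A).2 hA)
  exact ⟨R, hR⟩

theorem sum_ofReal_qf_le_traceENN (A : E →L[ℂ] E) {e : ι → E} (he : Orthonormal ℂ e)
    (s : Finset ι) : ∑ i ∈ s, ENNReal.ofReal (qf A (e i)) ≤ traceENN A := by
  let g : Fin s.card → ι := fun k => (s.equivFin.symm k : ι)
  have hg : Function.Injective g := Subtype.val_injective.comp s.equivFin.symm.injective
  have h1 : ∑ k, ENNReal.ofReal (qf A (e (g k))) = ∑ i ∈ s, ENNReal.ofReal (qf A (e i)) := by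
    rw [← Finset.sum_coe_sort s]
    exact s.equivFin.symm.sum_comp fun i : s => ENNReal.ofReal (qf A (e i))
  rw [← h1]
  exact le_iSup_of_le s.card (le_iSup_of_le (e ∘ g) (le_iSup_of_le (he.comp g hg) le_rfl))

theorem sum_qf_le_one {ρ : E →L[ℂ] E} (hρ : ρ ∈ states E) {e : ι → E} (he : Orthonormal ℂ e)
    (s : Finset ι) : ∑ i ∈ s, qf ρ (e i) ≤ 1 := by
  have h := sum_ofReal_qf_le_traceENN ρ he s
  rw [hρ.2, ← ENNReal.ofReal_sum_of_nonneg fun i _ => qf_nonneg hρ.1 _] at h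
  simpa using h

theorem summable_qf {ρ : E →L[ℂ] E} (hρ : ρ ∈ states E) {e : ι → E} (he : Orthonormal ℂ e) :
    Summable fun i => qf ρ (e i) :=
  summable_of_sum_le (fun _ => qf_nonneg hρ.1 _) (sum_qf_le_one hρ he)

theorem tsum_qf_le_one {ρ : E →L[ℂ] E} (hρ : ρ ∈ states E) {e : ι → E} (he : Orthonormal ℂ e) :
    ∑' i, qf ρ (e i) ≤ 1 :=
  (summable_qf hρ he).tsum_le_of_sum_le (sum_qf_le_one hρ he)

theorem sum_qf_conj_le {ρ : E →L[ℂ] E} (hρ : ρ ∈ states E) (V : E →L[ℂ] F) {f : ι → F}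
    (hf : Orthonormal ℂ f) (J : Finset ι) :
    ∑ i ∈ J, qf (V ∘L ρ ∘L adjoint V) (f i) ≤ ‖V‖ ^ 2 := by
  obtain ⟨R, hR⟩ := exists_eq_adjoint_comp_self hρ.1
  obtain ⟨s, hs⟩ := exists_isONB E
  obtain ⟨t, ht, hft⟩ := exists_isONB_of_orthonormal hf
  have h0 : ∀ x, qf (V ∘L ρ ∘L adjoint V) x = ‖adjoint (V ∘L adjoint R) x‖ ^ 2 := by
    intro x
    rw [qf_conj, hR, qf_adjoint_comp_self]
    simp
  have h1 : ∀ v, ‖(V ∘L adjoint R) v‖ ^ 2 ≤ ‖V‖ ^ 2 * ‖adjoint R v‖ ^ 2 := fun v => by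
    rw [← mul_pow]
    exact pow_le_pow_left₀ (norm_nonneg _) (V.le_opNorm _) 2
  have h2 : ∑' w : t, ENNReal.ofReal (‖adjoint (V ∘L adjoint R) (w : F)‖ ^ 2) ≤
      ENNReal.ofReal (‖V‖ ^ 2) := by
    rw [tsum_norm_sq_adjoint _ hs ht]
    refine (ENNReal.tsum_le_tsum fun v : s =>
      ENNReal.ofReal_le_ofReal (h1 v)).trans ?_
    simp only [ENNReal.ofReal_mul (sq_nonneg ‖V‖)]
    rw [ENNReal.tsum_mul_left, tsum_norm_sq_adjoint R hs hs]
    refine mul_le_of_le_one_right' ?_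
    simp only [← qf_adjoint_comp_self, ← hR]
    rw [← ENNReal.ofReal_tsum_of_nonneg (fun _ => qf_nonneg hρ.1 _) (summable_qf hρ hs.1)]
    simpa using tsum_qf_le_one hρ hs.1
  have hinj : Function.Injective fun i => (⟨f i, hft ⟨i, rfl⟩⟩ : t) := fun i j hij =>
    hf.linearIndependent.injective (congrArg Subtype.val hij)
  have h3 := (ENNReal.sum_le_tsum (J.map ⟨_, hinj⟩)).trans h2
  rw [Finset.sum_map] at h3
  simp only [Function.Embedding.coeFn_mk, ← h0] at h3
  have hnn : ∀ x, 0 ≤ qf (V ∘L ρ ∘L adjoint V) x := fun x => by rw [h0]; positivity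
  rw [← ENNReal.ofReal_sum_of_nonneg fun i _ => hnn _] at h3
  exact (ENNReal.ofReal_le_ofReal_iff (by positivity)).1 h3

/-- The diagonal of `V ρ V*` is summable in every orthonormal basis. -/
theorem summable_qf_conj {ρ : E →L[ℂ] E} (hρ : ρ ∈ states E) (V : E →L[ℂ] F) {t : Set F}
    (ht : IsONB t) : Summable fun w : t => qf (V ∘L ρ ∘L adjoint V) (w : F) :=
  summable_of_sum_le (fun w => by rw [qf_conj]; exact qf_nonneg hρ.1 _)
    (sum_qf_conj_le hρ V ht.1)
/-- Bessel's inequality for an orthogonal family. -/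
theorem sum_norm_inner_sq_div_le [Fintype ι] {u : ι → E}
    (hu : ∀ i j, i ≠ j → (inner ℂ (u i) (u j) : ℂ) = 0) (v : E) :
    ∑ i, ‖(inner ℂ v (u i) : ℂ)‖ ^ 2 / ‖u i‖ ^ 2 ≤ ‖v‖ ^ 2 := by
  let w : {i // u i ≠ 0} → E := fun i => ((‖u i‖⁻¹ : ℝ) : ℂ) • u i
  have hw : Orthonormal ℂ w := by
    refine ⟨fun i => ?_, fun i j hij => ?_⟩
    · have := norm_ne_zero_iff.2 i.2
      simp only [w, norm_smul, Complex.norm_real, norm_inv, norm_norm]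
      field_simp
    · simp only [w, inner_smul_left, inner_smul_right]
      rw [hu _ _ fun h => hij (Subtype.ext h)]
      simp
  have h := hw.tsum_inner_products_le v
  rw [← tsum_fintype (L := .unconditional _)]
  refine le_trans (le_of_eq ?_) h
  rw [← (Subtype.val_injective (p := fun i => u i ≠ 0)).tsum_eq
    (f := fun i => ‖(inner ℂ v (u i) : ℂ)‖ ^ 2 / ‖u i‖ ^ 2)]
  · refine tsum_congr fun i => ?_
    simp only [w, inner_smul_left, Complex.conj_ofReal, norm_mul, Complex.norm_real, norm_inv,
      norm_norm]
    rw [norm_inner_symm]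
    field_simp
  · intro i hi
    by_contra hc
    simp only [Subtype.range_coe_subtype, Set.mem_ofPred_eq, not_not] at hc
    simp [hc] at hi

/-- If `A` dominates `∑ |uᵢ⟩⟨uᵢ|` with mutually orthogonal `uᵢ`, then the entropy of `A` is at
least the classical entropy of the weights `‖uᵢ‖²`. -/
theorem clEntropy_le_qEntropy [Fintype ι] {A : E →L[ℂ] E}
    (hA : ∀ s : Set E, IsONB s → Summable fun v : s => qf A (v : E)) {u : ι → E}
    (hu : ∀ i j, i ≠ j → (inner ℂ (u i) (u j) : ℂ) = 0)
    (hle : ∀ x, ∑ i, ‖(inner ℂ x (u i) : ℂ)‖ ^ 2 ≤ qf A x) :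
    clEntropy (fun i => ‖u i‖ ^ 2) ≤ qEntropy A := by
  refine le_iInf fun s => le_iInf fun hs => ?_
  have h := clEntropy_le_of_substochastic
    (W := fun (v : s) i => ‖(inner ℂ (v : E) (u i) : ℂ)‖ ^ 2) (x := fun i => ‖u i‖ ^ 2)
    (fun _ _ => sq_nonneg _) (fun i => hs.hasSum_norm_inner_sq (u i)) (fun v => by
      simpa [hs.1.1 v] using sum_norm_inner_sq_div_le hu (v : E))
  exact h.trans (clEntropy_mono (fun v => Finset.sum_nonneg fun i _ => sq_nonneg _)
    (fun v => hle _) (hA s hs))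

/-- Homogeneity of the entropy. -/
theorem qEntropy_smul {c : ℝ} (hc : 0 < c) (A : E →L[ℂ] E) :
    qEntropy (c • A) = ENNReal.ofReal c * qEntropy A := by
  have h0 : ENNReal.ofReal c ≠ 0 := by simpa using hc
  simp only [qEntropy, qf_real_smul, clEntropy_const_mul hc.le,
    ENNReal.mul_iInf_of_ne h0 ENNReal.ofReal_ne_top]

/-- Monotonicity of the entropy. -/
theorem qEntropy_mono {A B : E →L[ℂ] E} (hA : ∀ x, 0 ≤ qf A x) (hAB : ∀ x, qf A x ≤ qf B x)
    (hB : ∀ s : Set E, IsONB s → Summable fun v : s => qf B (v : E)) :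
    qEntropy A ≤ qEntropy B :=
  iInf_mono fun s => iInf_mono fun hs =>
    clEntropy_mono (fun _ => hA _) (fun _ => hAB _) (hB s hs)

theorem abs_qf_le_traceNorm {A : E →L[ℂ] E} {δ : ℝ} (hδ : traceNorm A < ENNReal.ofReal δ)
    {e : ι → E} (he : Orthonormal ℂ e) (s : Finset ι) : ∑ i ∈ s, |qf A (e i)| ≤ δ := by
  let g : Fin s.card → ι := fun k => (s.equivFin.symm k : ι)
  have hg : Function.Injective g := Subtype.val_injective.comp s.equivFin.symm.injective
  have h1 : ∑ k, ENNReal.ofReal ‖(inner ℂ (e (g k)) (A (e (g k))) : ℂ)‖ =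
      ∑ i ∈ s, ENNReal.ofReal ‖(inner ℂ (e i) (A (e i)) : ℂ)‖ := by
    rw [← Finset.sum_coe_sort s]
    exact s.equivFin.symm.sum_comp
      fun i : s => ENNReal.ofReal ‖(inner ℂ (e i) (A (e i)) : ℂ)‖
  have h2 : ∑ i ∈ s, ENNReal.ofReal ‖(inner ℂ (e i) (A (e i)) : ℂ)‖ ≤ traceNorm A := by
    rw [← h1]
    exact le_iSup_of_le s.card (le_iSup_of_le (e ∘ g) (le_iSup_of_le (e ∘ g)
      (le_iSup_of_le (he.comp g hg) (le_iSup_of_le (he.comp g hg) le_rfl))))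
  have hδ0 : 0 < δ := ENNReal.ofReal_pos.1 (bot_le.trans_lt hδ)
  rw [← ENNReal.ofReal_sum_of_nonneg fun i _ => norm_nonneg _] at h2
  refine le_trans (Finset.sum_le_sum fun i _ => ?_)
    ((ENNReal.ofReal_le_ofReal_iff hδ0.le).1 (h2.trans hδ.le))
  exact Complex.abs_re_le_norm _

theorem abs_qf_le {A : E →L[ℂ] E} {δ : ℝ} (hδ : traceNorm A < ENNReal.ofReal δ) (x : E) :
    |qf A x| ≤ δ * ‖x‖ ^ 2 := by
  rcases eq_or_ne x 0 with rfl | hx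
  · simp [qf]
  · have hx' := norm_ne_zero_iff.2 hx
    have he : Orthonormal ℂ fun _ : Unit => ((‖x‖⁻¹ : ℝ) : ℂ) • x := by
      refine ⟨fun i => ?_, fun i j hij => (hij rfl).elim⟩
      rw [norm_smul, Complex.norm_real, norm_inv, norm_norm]
      field_simp
    have h := abs_qf_le_traceNorm hδ he Finset.univ
    simp only [Finset.univ_unique, Finset.sum_singleton, qf_smul_apply, Complex.norm_real,
      norm_inv, norm_norm, abs_mul, abs_pow, abs_inv, abs_norm] at h
    rw [inv_pow, inv_mul_le_iff₀ (by positivity)] at h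
    linarith

end Operators

/-! ### Finiteness of the output entropy -/

section Necessity

set_option linter.unusedSectionVars false

open ContinuousLinearMap (adjoint)

variable {E F ι : Type*}
variable [NormedAddCommGroup E] [InnerProductSpace ℂ E] [CompleteSpace E]
variable [NormedAddCommGroup F] [InnerProductSpace ℂ F] [CompleteSpace F]

theorem qf_le_norm_sq {ρ : E →L[ℂ] E} (hρ : ρ ∈ states E) (x : E) : qf ρ x ≤ ‖x‖ ^ 2 := by
  rcases eq_or_ne x 0 with rfl | hx
  · simp [qf]
  · have hx' := norm_ne_zero_iff.2 hx
    have he : Orthonormal ℂ fun _ : Unit => ((‖x‖⁻¹ : ℝ) : ℂ) • x := by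
      refine ⟨fun i => ?_, fun i j hij => (hij rfl).elim⟩
      rw [norm_smul, Complex.norm_real, norm_inv, norm_norm]
      field_simp
    have h := sum_qf_le_one hρ he Finset.univ
    simp only [Finset.univ_unique, Finset.sum_singleton, qf_smul_apply, Complex.norm_real,
      norm_inv, norm_norm] at h
    rwa [inv_pow, inv_mul_le_iff₀ (by positivity), mul_one] at h

theorem norm_le_one_of_mem_states {ρ : E →L[ℂ] E} (hρ : ρ ∈ states E) : ‖ρ‖ ≤ 1 := by
  obtain ⟨R, hR⟩ := exists_eq_adjoint_comp_self hρ.1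
  have hR1 : ‖R‖ ≤ 1 := by
    refine R.opNorm_le_bound zero_le_one fun x => ?_
    have h := qf_le_norm_sq hρ x
    rw [hR, qf_adjoint_comp_self] at h
    simpa using abs_le_of_sq_le_sq h (norm_nonneg x)
  calc ‖ρ‖ = ‖R‖ * ‖R‖ := by rw [hR, ContinuousLinearMap.norm_adjoint_comp_self]
    _ ≤ 1 := mul_le_one₀ hR1 (norm_nonneg _) hR1

theorem traceENN_smul {c : ℝ} (hc : 0 ≤ c) (A : E →L[ℂ] E) :
    traceENN (c • A) = ENNReal.ofReal c * traceENN A := by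
  simp only [traceENN, qf_real_smul, ENNReal.ofReal_mul hc, ← Finset.mul_sum, ENNReal.mul_iSup]

theorem traceENN_mono {A B : E →L[ℂ] E} (h : ∀ x, qf A x ≤ qf B x) : traceENN A ≤ traceENN B :=
  iSup_mono fun _ => iSup_mono fun _ => iSup_mono fun _ =>
    Finset.sum_le_sum fun _ _ => ENNReal.ofReal_le_ofReal (h _)

/-- If the output entropy is finite on all states, it is bounded. -/
theorem exists_bound_of_forall_ne_top {V : E →L[ℂ] F}
    (h : ∀ ρ ∈ states E, qEntropy (V ∘L ρ ∘L adjoint V) ≠ ∞) :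
    ∃ S : ℝ, 0 ≤ S ∧ ∀ ρ ∈ states E, qEntropy (V ∘L ρ ∘L adjoint V) ≤ ENNReal.ofReal S := by
  by_contra! hcon
  have hk : ∀ k : ℕ, ∃ ρ ∈ states E,
      ENNReal.ofReal (4 ^ k) < qEntropy (V ∘L ρ ∘L adjoint V) := fun k => hcon _ (by positivity)
  choose r hr hrH using hk
  have hsum : Summable fun k : ℕ => ((1 / 2 : ℝ) ^ k) • r k := by
    refine .of_norm_bounded summable_geometric_two fun k => ?_
    rw [norm_smul, Real.norm_of_nonneg (by positivity)]
    exact mul_le_of_le_one_right (by positivity) (norm_le_one_of_mem_states (hr k))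
  set σ : E →L[ℂ] E := ∑' k : ℕ, ((1 / 2 : ℝ) ^ k) • r k with hσ
  have hpos : ∀ k : ℕ, (((1 / 2 : ℝ) ^ k) • r k).IsPositive := fun k => by
    have := (hr k).1.smul_of_nonneg (c := (((1 / 2 : ℝ) ^ k : ℝ) : ℂ))
      (by exact_mod_cast (by positivity : (0 : ℝ) ≤ (1 / 2) ^ k))
    rwa [Complex.coe_smul] at this
  have hσpos : σ.IsPositive := (ContinuousLinearMap.nonneg_iff_isPositive _).1
    (tsum_nonneg fun k => (ContinuousLinearMap.nonneg_iff_isPositive _).2 (hpos k))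
  have hqf : ∀ x, HasSum (fun k : ℕ => (1 / 2 : ℝ) ^ k * qf (r k) x) (qf σ x) := by
    intro x
    have h1 := hsum.hasSum.mapL (ContinuousLinearMap.apply ℂ E x)
    have h2 := (h1.mapL (innerSL ℂ x)).mapL Complex.reCLM
    simp only [← qf_real_smul]
    exact h2
  have hqle : ∀ k x, (1 / 2 : ℝ) ^ k * qf (r k) x ≤ qf σ x := fun k x =>
    le_hasSum (hqf x) k fun j _ => mul_nonneg (by positivity) (qf_nonneg (hr j).1 x)
  have ht1 : 1 ≤ traceENN σ := by
    rw [← (hr 0).2]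
    exact traceENN_mono fun x => by simpa using hqle 0 x
  have ht2 : traceENN σ ≤ ENNReal.ofReal 2 := by
    refine iSup_le fun n => iSup_le fun e => iSup_le fun he => ?_
    rw [← ENNReal.ofReal_sum_of_nonneg fun i _ => qf_nonneg hσpos _]
    refine ENNReal.ofReal_le_ofReal ?_
    refine hasSum_le (fun k => ?_) (hasSum_sum fun i _ => hqf (e i)) hasSum_geometric_two
    rw [← Finset.mul_sum]
    exact mul_le_of_le_one_right (by positivity) (sum_qf_le_one (hr k) he _)
  have htop : traceENN σ ≠ ∞ := (ht2.trans_lt ENNReal.ofReal_lt_top).ne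
  set t := (traceENN σ).toReal with ht
  have htσ : ENNReal.ofReal t = traceENN σ := ENNReal.ofReal_toReal htop
  have ht1' : 1 ≤ t := by
    rw [← htσ] at ht1
    simpa using ht1
  have ht2' : t ≤ 2 := by
    rw [← htσ] at ht2
    exact (ENNReal.ofReal_le_ofReal_iff (by norm_num)).1 ht2
  have ht0 : 0 < t := by linarith
  have hst : t⁻¹ • σ ∈ states E := by
    refine ⟨?_, ?_⟩
    · have := hσpos.smul_of_nonneg (c := ((t⁻¹ : ℝ) : ℂ))
        (by exact_mod_cast (by positivity : (0 : ℝ) ≤ t⁻¹))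
      rwa [Complex.coe_smul] at this
    · rw [traceENN_smul (by positivity), ← htσ, ← ENNReal.ofReal_mul (by positivity)]
      simp [ht0.ne']
  have hlow : ∀ k : ℕ, ENNReal.ofReal (2 ^ k / 2) ≤
      qEntropy (V ∘L (t⁻¹ • σ) ∘L adjoint V) := by
    intro k
    have hc : 0 < t⁻¹ * (1 / 2 : ℝ) ^ k := by positivity
    calc ENNReal.ofReal (2 ^ k / 2)
        ≤ ENNReal.ofReal (t⁻¹ * (1 / 2 : ℝ) ^ k * 4 ^ k) := by
          refine ENNReal.ofReal_le_ofReal ?_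
          have h1 : (1 / 2 : ℝ) ^ k * 4 ^ k = 2 ^ k := by rw [← mul_pow]; norm_num
          have h2 : (2 : ℝ)⁻¹ ≤ t⁻¹ := inv_anti₀ ht0 ht2'
          rw [mul_assoc, h1, div_eq_inv_mul]
          gcongr
      _ = ENNReal.ofReal (t⁻¹ * (1 / 2 : ℝ) ^ k) * ENNReal.ofReal (4 ^ k) :=
          ENNReal.ofReal_mul hc.le
      _ ≤ ENNReal.ofReal (t⁻¹ * (1 / 2 : ℝ) ^ k) * qEntropy (V ∘L r k ∘L adjoint V) := by
          gcongr
          exact (hrH k).le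
      _ = qEntropy ((t⁻¹ * (1 / 2 : ℝ) ^ k) • (V ∘L r k ∘L adjoint V)) :=
          (qEntropy_smul hc _).symm
      _ ≤ _ := by
          refine qEntropy_mono (fun x => ?_) (fun x => ?_)
            fun s hs => summable_qf_conj hst V hs
          · rw [qf_real_smul, qf_conj]
            exact mul_nonneg hc.le (qf_nonneg (hr k).1 _)
          · rw [qf_real_smul, qf_conj, qf_conj, qf_real_smul, mul_assoc]
            exact mul_le_mul_of_nonneg_left (hqle k _) (by positivity)
  refine h _ hst (ENNReal.eq_top_of_forall_nnreal_le fun y => ?_)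
  obtain ⟨k, hk⟩ := pow_unbounded_of_one_lt ((y : ℝ) * 2) (one_lt_two)
  refine le_trans ?_ (hlow k)
  rw [← ENNReal.ofReal_coe_nnreal]
  exact ENNReal.ofReal_le_ofReal (by linarith)

theorem qf_rankOne (e x : E) : qf (rankOne e) x = ‖(inner ℂ x e : ℂ)‖ ^ 2 := by
  rw [qf, rankOne, ContinuousLinearMap.smulRight_apply, innerSL_apply_apply, inner_smul_right,
    ← inner_conj_symm e x, ← Complex.normSq_eq_conj_mul_self, Complex.ofReal_re,
    Complex.normSq_eq_norm_sq]

theorem rankOne_isPositive (e : E) : (rankOne e).IsPositive :=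
  InnerProductSpace.isPositive_rankOne_self (𝕜 := ℂ) e

theorem qf_sum [Fintype ι] (A : ι → E →L[ℂ] E) (x : E) :
    qf (∑ i, A i) x = ∑ i, qf (A i) x := by
  simp [qf]

/-- A mixture of orthonormal pure states is a state. -/
theorem sum_smul_rankOne_mem_states [Fintype ι] {e : ι → E} (he : Orthonormal ℂ e)
    {p : ι → ℝ} (hp : ∀ i, 0 ≤ p i) (hp1 : ∑ i, p i = 1) :
    ∑ i, p i • rankOne (e i) ∈ states E := by
  refine ⟨ContinuousLinearMap.isPositive_sum _ fun i _ => ?_, le_antisymm ?_ ?_⟩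
  · have := (rankOne_isPositive (e i)).smul_of_nonneg (c := ((p i : ℝ) : ℂ))
      (by exact_mod_cast hp i)
    rwa [Complex.coe_smul] at this
  · refine iSup_le fun n => iSup_le fun g => iSup_le fun hg => ?_
    simp only [qf_sum, qf_real_smul, qf_rankOne]
    rw [← ENNReal.ofReal_sum_of_nonneg fun k _ =>
      Finset.sum_nonneg fun i _ => mul_nonneg (hp i) (sq_nonneg _), Finset.sum_comm]
    rw [← ENNReal.ofReal_one, ← hp1]
    refine ENNReal.ofReal_le_ofReal (Finset.sum_le_sum fun i _ => ?_)
    rw [← Finset.mul_sum]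
    refine mul_le_of_le_one_right (hp i) ?_
    simpa [he.1 i] using hg.sum_inner_products_le (e i) (s := Finset.univ)
  · refine le_trans (le_of_eq ?_) (sum_ofReal_qf_le_traceENN _ he Finset.univ)
    have : ∀ j, qf (∑ i, p i • rankOne (e i)) (e j) = p j := by
      intro j
      simp only [qf_sum, qf_real_smul, qf_rankOne]
      rw [Finset.sum_eq_single j]
      · rw [inner_self_eq_norm_sq_to_K, he.1 j]; simp
      · intro i _ hij
        simp [he.2 hij.symm]
      · simp
    simp only [this]
    rw [← ENNReal.ofReal_sum_of_nonneg fun i _ => hp i, hp1, ENNReal.ofReal_one]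

/-- A bound on the output entropy bounds the partition function of every finite family of
orthonormal vectors with nonzero, mutually orthogonal images. -/
theorem sum_exp_le_one [Fintype ι] {V : E →L[ℂ] F} {S : ℝ} (hS : 0 ≤ S)
    (h : ∀ ρ ∈ states E, qEntropy (V ∘L ρ ∘L adjoint V) ≤ ENNReal.ofReal S) {e : ι → E}
    (he : Orthonormal ℂ e) (hV : ∀ i j, i ≠ j → (inner ℂ (V (e i)) (V (e j)) : ℂ) = 0)
    (hV0 : ∀ i, V (e i) ≠ 0) : ∑ i, Real.exp (-(S / ‖V (e i)‖ ^ 2)) ≤ 1 := by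
  by_contra! hZ
  set Z := ∑ i, Real.exp (-(S / ‖V (e i)‖ ^ 2)) with hZdef
  have hZ0 : 0 < Z := one_pos.trans hZ
  have hν : ∀ i, 0 < ‖V (e i)‖ := fun i => norm_pos_iff.2 (hV0 i)
  let q : ι → ℝ := fun i => Real.exp (-(S / ‖V (e i)‖ ^ 2)) / Z
  have hq : ∀ i, 0 < q i := fun i => by positivity
  have hq1 : ∑ i, q i = 1 := by
    simp only [q, ← Finset.sum_div]; exact div_self hZ0.ne'
  have hne : Nonempty ι := by
    by_contra hc
    rw [not_nonempty_iff] at hc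
    simp at hq1
  set m := ∑ i, q i / ‖V (e i)‖ ^ 2 with hm
  have hm0 : 0 < m := Finset.sum_pos (fun i _ => div_pos (hq i) (pow_pos (hν i) 2))
    Finset.univ_nonempty
  let p : ι → ℝ := fun i => q i / ‖V (e i)‖ ^ 2 / m
  have hp : ∀ i, 0 ≤ p i := fun i =>
    div_nonneg (div_nonneg (hq i).le (sq_nonneg _)) hm0.le
  have hp1 : ∑ i, p i = 1 := by
    simp only [p, ← Finset.sum_div]; exact div_self hm0.ne'
  have hst := sum_smul_rankOne_mem_states he hp hp1
  have hqf : ∀ x, qf (V ∘L (∑ i, p i • rankOne (e i)) ∘L adjoint V) x =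
      ∑ i, ‖(inner ℂ x (((√(p i) : ℝ) : ℂ) • V (e i)) : ℂ)‖ ^ 2 := by
    intro x
    rw [qf_conj, qf_sum]
    refine Finset.sum_congr rfl fun i _ => ?_
    rw [qf_real_smul, qf_rankOne, ContinuousLinearMap.adjoint_inner_left, inner_smul_right,
      norm_mul, mul_pow, Complex.norm_real, Real.norm_of_nonneg (Real.sqrt_nonneg _),
      Real.sq_sqrt (hp i)]
  have h1 := clEntropy_le_qEntropy (fun s hs => summable_qf_conj hst V hs)
    (u := fun i => ((√(p i) : ℝ) : ℂ) • V (e i)) (fun i j hij => by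
      rw [inner_smul_left, inner_smul_right, hV i j hij]; simp) fun x => (hqf x).ge
  have h2 : (fun i => ‖((√(p i) : ℝ) : ℂ) • V (e i)‖ ^ 2) = fun i => m⁻¹ * q i := by
    ext i
    have := hν i
    rw [norm_smul, Complex.norm_real, Real.norm_of_nonneg (Real.sqrt_nonneg _), mul_pow,
      Real.sq_sqrt (hp i)]
    simp only [p]
    field_simp
  have h3 : ∑ i, Real.negMulLog (q i) - Real.negMulLog (∑ i, q i) = S * m + Real.log Z := by
    rw [hq1, Real.negMulLog_one, sub_zero]
    have : ∀ i, Real.negMulLog (q i) = S * (q i / ‖V (e i)‖ ^ 2) + q i * Real.log Z := by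
      intro i
      have h4 : Real.log (q i) = -(S / ‖V (e i)‖ ^ 2) - Real.log Z := by
        rw [Real.log_div (Real.exp_pos _).ne' hZ0.ne', Real.log_exp]
      rw [Real.negMulLog, h4]
      ring
    simp only [this, Finset.sum_add_distrib, ← Finset.mul_sum, ← Finset.sum_mul, hq1, one_mul,
      ← hm]
  rw [h2, clEntropy_const_mul (by positivity), clEntropy_fintype fun i => (hq i).le, h3,
    ← ENNReal.ofReal_mul (by positivity)] at h1
  have h5 := (ENNReal.ofReal_le_ofReal_iff hS).1 (h1.trans (h _ hst))
  have h6 := Real.log_pos hZ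
  rw [inv_mul_le_iff₀ hm0] at h5
  linarith

/-- A non-compact operator is bounded below on a unit vector of the orthogonal complement of
every finite-dimensional subspace. -/
theorem exists_norm_ge_of_not_isCompactOperator {V : E →L[ℂ] F} (hV : ¬ IsCompactOperator V) :
    ∃ c : ℝ, 0 < c ∧ ∀ M : Submodule ℂ E, FiniteDimensional ℂ M →
      ∃ x ∈ Mᗮ, ‖x‖ = 1 ∧ c ≤ ‖V x‖ := by
  by_contra! hcon
  refine hV ?_
  have hcl : V ∈ closure {A : E →L[ℂ] F | IsCompactOperator A} := by
    refine Metric.mem_closure_iff.2 fun ε hε => ?_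
    obtain ⟨M, hM, hlt⟩ := hcon (ε / 2) (by positivity)
    refine ⟨V ∘L M.starProjection, ?_, ?_⟩
    · have h1 : IsCompactOperator (id : M → M) :=
        (isCompactOperator_id_iff_finiteDimensional (𝕜 := ℂ)).2 hM
      exact (h1.comp_clm M.orthogonalProjectionOnto).clm_comp (V ∘L M.subtypeL)
    · rw [dist_eq_norm]
      refine lt_of_le_of_lt (ContinuousLinearMap.opNorm_le_bound _ (half_pos hε).le fun x => ?_)
        (half_lt_self hε)
      have h2 : (V - V ∘L M.starProjection) x = V (x - M.starProjection x) := by simp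
      have h3 : x - M.starProjection x ∈ Mᗮ := M.sub_starProjection_mem_orthogonal x
      have h4 : ‖x - M.starProjection x‖ ≤ ‖x‖ := by
        have h5 : x - M.starProjection x = Mᗮ.starProjection x := by
          rw [Submodule.starProjection_orthogonal]; simp
        rw [h5]
        exact Mᗮ.norm_starProjection_apply_le x
      rw [h2]
      set y := x - M.starProjection x
      rcases eq_or_ne y 0 with hy | hy
      · rw [hy]; simp; positivity
      · have hy' := norm_pos_iff.2 hy
        have h6 := hlt (((‖y‖⁻¹ : ℝ) : ℂ) • y) (Mᗮ.smul_mem _ h3) (by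
          rw [norm_smul, Complex.norm_real, norm_inv, norm_norm]; field_simp)
        rw [map_smul, norm_smul, Complex.norm_real, norm_inv, norm_norm,
          inv_mul_lt_iff₀ hy'] at h6
        nlinarith
  rwa [isClosed_setOfPred_isCompactOperator.closure_eq] at hcl

/-- An operator with bounded output entropy is compact. -/
theorem isCompactOperator_of_bound {V : E →L[ℂ] F} {S : ℝ} (hS : 0 ≤ S)
    (h : ∀ ρ ∈ states E, qEntropy (V ∘L ρ ∘L adjoint V) ≤ ENNReal.ofReal S) :
    IsCompactOperator V := by
  by_contra hV
  obtain ⟨c, hc, hx⟩ := exists_norm_ge_of_not_isCompactOperator hV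
  obtain ⟨e, he, hr⟩ := exists_seq_of_forall_finset_exists
    (fun x : E => ‖x‖ = 1 ∧ c ≤ ‖V x‖)
    (fun x y => (inner ℂ x y : ℂ) = 0 ∧ (inner ℂ (V x) (V y) : ℂ) = 0) (by
      intro s _
      obtain ⟨y, hy, hy1, hyc⟩ := hx
        (Submodule.span ℂ ((s ∪ s.image fun x => adjoint V (V x) : Finset E) : Set E))
        (FiniteDimensional.span_finset ℂ _)
      refine ⟨y, ⟨hy1, hyc⟩, fun x hxs => ⟨?_, ?_⟩⟩
      · exact (Submodule.mem_orthogonal _ _).1 hy x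
          (Submodule.subset_span (by simp [hxs]))
      · rw [← ContinuousLinearMap.adjoint_inner_left]
        exact (Submodule.mem_orthogonal _ _).1 hy _
          (Submodule.subset_span (by
            simp only [Finset.coe_union, Finset.coe_image]
            exact Or.inr ⟨x, hxs, rfl⟩)))
  have hboth : ∀ i j, i ≠ j → (inner ℂ (e i) (e j) : ℂ) = 0 ∧
      (inner ℂ (V (e i)) (V (e j)) : ℂ) = 0 := by
    intro i j hij
    rcases lt_or_gt_of_ne hij with hlt | hlt
    · exact hr i j hlt
    · exact ⟨inner_eq_zero_symm.1 (hr j i hlt).1, inner_eq_zero_symm.1 (hr j i hlt).2⟩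
  have hon : Orthonormal ℂ e := ⟨fun i => (he i).1, fun i j hij => (hboth i j hij).1⟩
  have hcard : ∀ n : ℕ, (n : ℝ) * Real.exp (-(S / c ^ 2)) ≤ 1 := by
    intro n
    have h1 := sum_exp_le_one hS h (e := fun i : Fin n => e i)
      (hon.comp _ Fin.val_injective)
      (fun i j hij => (hboth _ _ fun hc => hij (Fin.ext hc)).2)
      (fun i => norm_pos_iff.1 (hc.trans_le (he i).2))
    refine le_trans ?_ h1
    have h2 : ∑ _i : Fin n, Real.exp (-(S / c ^ 2)) = n * Real.exp (-(S / c ^ 2)) := by simp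
    rw [← h2]
    refine Finset.sum_le_sum fun i _ => ?_
    have := (he i).2
    gcongr
  obtain ⟨n, hn⟩ := exists_nat_gt (Real.exp (-(S / c ^ 2)))⁻¹
  have h3 := hcard n
  rw [← le_div_iff₀ (Real.exp_pos _), one_div] at h3
  linarith

theorem Orthonormal.countable_of_separable [TopologicalSpace.SeparableSpace E] {e : ι → E}
    (he : Orthonormal ℂ e) : Countable ι := by
  refine Pairwise.countable_of_isOpen_disjoint (s := fun i => Metric.ball (e i) (1 / 2))
    (fun i j hij => ?_) (fun _ => Metric.isOpen_ball) fun i => ⟨e i, by simp⟩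
  refine Metric.ball_disjoint_ball ?_
  have h := norm_sub_sq (𝕜 := ℂ) (e i) (e j)
  rw [he.2 hij, he.1 i, he.1 j] at h
  rw [dist_eq_norm]
  norm_num at h
  nlinarith [norm_nonneg (e i - e j)]

/-- A compact operator on a separable Hilbert space has a sequence of singular values. -/
theorem exists_isSingularValues [TopologicalSpace.SeparableSpace E] {V : E →L[ℂ] F}
    (hV : IsCompactOperator V) : ∃ ν : ℕ → ℝ, IsSingularValues V ν := by
  set T : E →L[ℂ] E := adjoint V ∘L V with hTdef
  have hTc : IsCompactOperator T := hV.clm_comp (adjoint V)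
  have hTpos : T.IsPositive := ContinuousLinearMap.isPositive_adjoint_comp_self V
  have hTs : (T : E →ₗ[ℂ] E).IsSymmetric := hTpos.isSymmetric
  have hfd : ∀ μ : {μ : ℂ // μ ≠ 0},
      FiniteDimensional ℂ (Module.End.eigenspace (T : E →ₗ[ℂ] E) μ.1) := fun μ =>
    ContinuousLinearMap.finite_dimensional_eigenspace hTc μ.1 μ.2
  let B := fun μ : {μ : ℂ // μ ≠ 0} =>
    stdOrthonormalBasis ℂ (Module.End.eigenspace (T : E →ₗ[ℂ] E) μ.1)
  let b : (Σ μ : {μ : ℂ // μ ≠ 0},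
      Fin (Module.finrank ℂ (Module.End.eigenspace (T : E →ₗ[ℂ] E) μ.1))) → E :=
    fun a => (B a.1 a.2 : E)
  have hb : Orthonormal ℂ b :=
    (hTs.orthogonalFamily_eigenspaces.comp Subtype.val_injective).orthonormal_sigma_orthonormal
      fun μ => (B μ).orthonormal
  have hcount := Orthonormal.countable_of_separable hb
  obtain ⟨g, hg⟩ := exists_injective_nat (Σ μ : {μ : ℂ // μ ≠ 0},
      Fin (Module.finrank ℂ (Module.End.eigenspace (T : E →ₗ[ℂ] E) μ.1)))
  have heig : ∀ a, T (b a) = a.1.1 • b a := fun a =>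
    Module.End.mem_eigenspace_iff.1 (B a.1 a.2).2
  have hval : ∀ a, a.1.1 = ((‖V (b a)‖ ^ 2 : ℝ) : ℂ) := by
    intro a
    have h1 : (inner ℂ (b a) (T (b a)) : ℂ) = ((‖V (b a)‖ ^ 2 : ℝ) : ℂ) := by
      rw [hTdef, ContinuousLinearMap.comp_apply, ContinuousLinearMap.adjoint_inner_right,
        inner_self_eq_norm_sq_to_K]
      simp
    rw [heig, inner_smul_right, inner_self_eq_norm_sq_to_K, hb.1 a] at h1
    simpa using h1
  let e : ℕ → E := Function.extend g b 0
  have hcase : ∀ n, (∃ a, g a = n ∧ e n = b a) ∨ e n = 0 := by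
    intro n
    by_cases hn : ∃ a, g a = n
    · obtain ⟨a, rfl⟩ := hn
      exact Or.inl ⟨a, rfl, hg.extend_apply _ _ _⟩
    · exact Or.inr (Function.extend_apply' _ _ _ hn)
  refine ⟨fun n => ‖V (e n)‖, fun n => norm_nonneg _, e, ?_, ?_, ?_, ?_⟩
  · intro i j hij
    rcases hcase i with ⟨a, ha, hea⟩ | h0
    · rcases hcase j with ⟨a', ha', hea'⟩ | h0
      · rw [hea, hea']
        refine hb.2 fun h => hij ?_
        rw [← ha, ← ha', h]
      · simp [h0]
    · simp [h0]
  · intro i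
    rcases hcase i with ⟨a, ha, hea⟩ | h0
    · refine ⟨fun _ => by rw [hea]; exact hb.1 a, fun h => ?_⟩
      replace h : ‖V (e i)‖ ^ 2 = 0 := h
      rw [hea] at h
      exact (a.1.2 (by rw [hval a, h, Complex.ofReal_zero])).elim
    · refine ⟨fun h => ?_, fun _ => h0⟩
      simp [h0] at h
  · intro i
    rcases hcase i with ⟨a, ha, hea⟩ | h0
    · change T (e i) = ((‖V (e i)‖ ^ 2 : ℝ) : ℂ) • e i
      rw [hea, heig, hval]
    · simp [h0]
  · intro x hx
    have hxb : ∀ a, (inner ℂ (b a) x : ℂ) = 0 := fun a => by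
      have := hx (g a)
      rwa [show e (g a) = b a from hg.extend_apply _ _ _] at this
    have hxμ : ∀ (μ : ℂ) (hμ : μ ≠ 0), ∀ y ∈ Module.End.eigenspace (T : E →ₗ[ℂ] E) μ,
        (inner ℂ y x : ℂ) = 0 := by
      intro μ hμ y hy
      have h1 := congrArg Subtype.val ((B ⟨μ, hμ⟩).sum_repr' ⟨y, hy⟩)
      simp only [Submodule.coe_sum, Submodule.coe_smul] at h1
      rw [← h1, sum_inner]
      refine Finset.sum_eq_zero fun k _ => ?_
      rw [inner_smul_left, hxb ⟨⟨μ, hμ⟩, k⟩, mul_zero]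
    have hTx : T x ∈ (⨆ μ, Module.End.eigenspace (T : E →ₗ[ℂ] E) μ)ᗮ := by
      rw [← Submodule.iInf_orthogonal, Submodule.mem_iInf]
      intro μ
      rw [Submodule.mem_orthogonal]
      intro y hy
      have h1 : (inner ℂ y (T x) : ℂ) = inner ℂ (T y) x := (hTs y x).symm
      have h2 : T y = μ • y := Module.End.mem_eigenspace_iff.1 hy
      rw [h1, h2, inner_smul_left]
      rcases eq_or_ne μ 0 with rfl | hμ
      · simp
      · rw [hxμ μ hμ y hy, mul_zero]
    rw [ContinuousLinearMap.orthogonalComplement_iSup_eigenspaces_eq_bot hTc hTs] at hTx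
    exact (Submodule.mem_bot ℂ).1 hTx

end Necessity

/-! ### Singular value decompositions and upper bounds on the output entropy -/

section SingularValues

set_option linter.unusedSectionVars false

open ContinuousLinearMap (adjoint)

variable {E F ι : Type*}
variable [NormedAddCommGroup E] [InnerProductSpace ℂ E] [CompleteSpace E]
variable [NormedAddCommGroup F] [InnerProductSpace ℂ F] [CompleteSpace F]

/-- `e` is an orthonormal family of right singular vectors of `V`, with nonzero singular
values `ν`, whose orthogonal complement is the kernel of `V`. -/
structure IsSVD (V : E →L[ℂ] F) (e : ι → E) (ν : ι → ℝ) : Prop where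
  orthonormal : Orthonormal ℂ e
  pos : ∀ i, 0 < ν i
  eigen : ∀ i, adjoint V (V (e i)) = ((ν i ^ 2 : ℝ) : ℂ) • e i
  ker : ∀ x, (∀ i, (inner ℂ (e i) x : ℂ) = 0) → V x = 0

/-- The left singular vectors of a singular value decomposition. -/
def leftVec (V : E →L[ℂ] F) (e : ι → E) (ν : ι → ℝ) (i : ι) : F := (((ν i)⁻¹ : ℝ) : ℂ) • V (e i)

theorem apply_eq_zero_of_adjoint_comp_self {V : E →L[ℂ] F} {x : E} (h : adjoint V (V x) = 0) :
    V x = 0 := by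
  rw [← inner_self_eq_zero (𝕜 := ℂ), ← ContinuousLinearMap.adjoint_inner_right, h,
    inner_zero_right]

theorem IsSingularValues.exists_isSVD {V : E →L[ℂ] F} {ν : ℕ → ℝ} (h : IsSingularValues V ν) :
    ∃ e : {i // ν i ≠ 0} → E, IsSVD V e fun i => ν i := by
  obtain ⟨hν, e, horth, hnorm, heig, hker⟩ := h
  refine ⟨fun i => e i, ⟨fun i => (hnorm i).1 (pow_ne_zero 2 i.2), fun i j hij =>
    horth _ _ fun h => hij (Subtype.ext h)⟩, fun i => lt_of_le_of_ne (hν i) (Ne.symm i.2),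
    fun i => heig i, fun x hx => apply_eq_zero_of_adjoint_comp_self (hker x fun i => ?_)⟩
  by_cases hi : ν i = 0
  · rw [(hnorm i).2 (by simp [hi]), inner_zero_left]
  · exact hx ⟨i, hi⟩

variable {V : E →L[ℂ] F} {e : ι → E} {ν : ι → ℝ}

theorem IsSVD.inner_apply (h : IsSVD V e ν) (i j : ι) :
    (inner ℂ (V (e i)) (V (e j)) : ℂ) = ((ν j ^ 2 : ℝ) : ℂ) * inner ℂ (e i) (e j) := by
  rw [← ContinuousLinearMap.adjoint_inner_right, h.eigen, inner_smul_right]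

theorem IsSVD.norm_apply (h : IsSVD V e ν) (i : ι) : ‖V (e i)‖ = ν i := by
  have h1 := h.inner_apply i i
  rw [inner_self_eq_norm_sq_to_K, inner_self_eq_norm_sq_to_K, h.orthonormal.1 i] at h1
  have h2 : ‖V (e i)‖ ^ 2 = ν i ^ 2 := by
    have : ((‖V (e i)‖ ^ 2 : ℝ) : ℂ) = ((ν i ^ 2 : ℝ) : ℂ) := by simpa using h1
    exact_mod_cast this
  exact (pow_left_inj₀ (norm_nonneg _) (h.pos i).le two_ne_zero).1 h2

theorem IsSVD.le_norm (h : IsSVD V e ν) (i : ι) : ν i ≤ ‖V‖ := by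
  rw [← h.norm_apply i]
  exact V.unit_le_opNorm _ (h.orthonormal.1 i).le

theorem IsSVD.orthonormal_leftVec (h : IsSVD V e ν) : Orthonormal ℂ (leftVec V e ν) := by
  refine ⟨fun i => ?_, fun i j hij => ?_⟩
  · rw [leftVec, norm_smul, h.norm_apply, Complex.norm_real, norm_inv,
      Real.norm_of_nonneg (h.pos i).le, inv_mul_cancel₀ (h.pos i).ne']
  · change (inner ℂ (leftVec V e ν i) (leftVec V e ν j) : ℂ) = 0
    rw [leftVec, leftVec, inner_smul_left, inner_smul_right, h.inner_apply,
      h.orthonormal.2 hij]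
    simp

theorem IsSVD.adjoint_leftVec (h : IsSVD V e ν) (i : ι) :
    adjoint V (leftVec V e ν i) = ((ν i : ℝ) : ℂ) • e i := by
  rw [leftVec, map_smul, h.eigen, smul_smul, ← Complex.ofReal_mul]
  congr 2
  field_simp [(h.pos i).ne']

theorem IsSVD.adjoint_eq_zero (h : IsSVD V e ν) {w : F}
    (hw : ∀ i, (inner ℂ (leftVec V e ν i) w : ℂ) = 0) : adjoint V w = 0 := by
  have h1 : V (adjoint V w) = 0 := h.ker _ fun i => by
    have h2 := hw i
    rw [leftVec, inner_smul_left, ← ContinuousLinearMap.adjoint_inner_right] at h2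
    refine (mul_eq_zero.1 h2).resolve_left ?_
    simp [(h.pos i).ne']
  refine apply_eq_zero_of_adjoint_comp_self (V := adjoint V) ?_
  rw [ContinuousLinearMap.adjoint_adjoint, h1]

/-- The entropy of `V ρ V*` is at most that of its diagonal in an orthonormal family whose
orthogonal complement is annihilated by `V*`. -/
theorem qEntropy_conj_le (ρ : E →L[ℂ] E) {f : ι → F} (hf : Orthonormal ℂ f)
    (hker : ∀ w, (∀ i, (inner ℂ (f i) w : ℂ) = 0) → adjoint V w = 0) :
    qEntropy (V ∘L ρ ∘L adjoint V) ≤ clEntropy fun i => qf ρ (adjoint V (f i)) := by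
  obtain ⟨s, hs, hfs⟩ := exists_isONB_of_orthonormal hf
  have hinj : Function.Injective fun i => (⟨f i, hfs ⟨i, rfl⟩⟩ : s) := fun i j hij =>
    hf.linearIndependent.injective (congrArg Subtype.val hij)
  refine (iInf₂_le s hs).trans (le_of_eq ?_)
  simp only [qf_conj]
  refine (clEntropy_comp_of_injective (x := fun v : s => qf ρ (adjoint V (v : F))) hinj
    fun v hv => ?_).symm
  rw [hker v fun i => hs.1.2 (i := ⟨f i, hfs ⟨i, rfl⟩⟩) (j := v) fun h => hv ⟨i, h⟩]
  simp [qf]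

theorem summable_qf_adjoint {ρ : E →L[ℂ] E} (hρ : ρ ∈ states E) {f : ι → F}
    (hf : Orthonormal ℂ f) : Summable fun i => qf ρ (adjoint V (f i)) :=
  summable_of_sum_le (fun _ => qf_nonneg hρ.1 _) fun J => by
    simpa only [qf_conj] using sum_qf_conj_le hρ V hf J

theorem tsum_qf_adjoint_le {ρ : E →L[ℂ] E} (hρ : ρ ∈ states E) {f : ι → F}
    (hf : Orthonormal ℂ f) : ∑' i, qf ρ (adjoint V (f i)) ≤ ‖V‖ ^ 2 :=
  (summable_qf_adjoint hρ hf).tsum_le_of_sum_le fun J => by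
    simpa only [qf_conj] using sum_qf_conj_le hρ V hf J

theorem IsSVD.qf_adjoint_leftVec (h : IsSVD V e ν) (ρ : E →L[ℂ] E) (i : ι) :
    qf ρ (adjoint V (leftVec V e ν i)) = ν i ^ 2 * qf ρ (e i) := by
  rw [h.adjoint_leftVec, qf_smul_apply, Complex.norm_real, Real.norm_of_nonneg (h.pos i).le]

/-- The Gibbs bound for a part of the diagonal of `V ρ V*` in the singular basis. -/
theorem IsSVD.clEntropy_indicator_le (h : IsSVD V e ν) {ρ : E →L[ℂ] E} (hρ : ρ ∈ states E)
    (J : Set ι) {l Z : ℝ} (hZ : 0 < Z)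
    (hsum : ∑' i, ENNReal.ofReal (Real.exp (-(l / ν i ^ 2))) ≤ ENNReal.ofReal Z) :
    clEntropy (J.indicator fun i => ν i ^ 2 * qf ρ (e i)) ≤
      ENNReal.ofReal (l * (∑' i, J.indicator (fun i => qf ρ (e i)) i) +
        (∑' i, J.indicator (fun i => ν i ^ 2 * qf ρ (e i)) i) * Real.log Z) := by
  have hs : Summable fun i => ν i ^ 2 * qf ρ (e i) := by
    simpa only [h.qf_adjoint_leftVec] using
      summable_qf_adjoint (V := V) hρ h.orthonormal_leftVec
  have hmul : ∀ i, J.indicator (fun i => ν i ^ 2 * qf ρ (e i)) i * (ν i ^ 2)⁻¹ =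
      J.indicator (fun i => qf ρ (e i)) i := fun i => by
    have := (h.pos i).ne'
    by_cases hi : i ∈ J
    · simp only [Set.indicator_of_mem hi]
      field_simp
    · simp [Set.indicator_of_notMem hi]
  have h1 := clEntropy_le_gibbs (x := J.indicator fun i => ν i ^ 2 * qf ρ (e i))
    (h := fun i => (ν i ^ 2)⁻¹) (l := l)
    (fun i => Set.indicator_nonneg (fun i _ => mul_nonneg (sq_nonneg _) (qf_nonneg hρ.1 _)) i)
    (hs.indicator J) (by
      simp only [hmul]
      exact (summable_qf hρ h.orthonormal).indicator J) hZ (by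
      simpa only [← div_eq_mul_inv] using hsum)
  simpa only [hmul] using h1

/-- The Gibbs bound on the output entropy. -/
theorem IsSVD.qEntropy_le (h : IsSVD V e ν) {ρ : E →L[ℂ] E} (hρ : ρ ∈ states E) {l Z : ℝ}
    (hZ : 0 < Z) (hsum : ∑' i, ENNReal.ofReal (Real.exp (-(l / ν i ^ 2))) ≤ ENNReal.ofReal Z) :
    qEntropy (V ∘L ρ ∘L adjoint V) ≤ ENNReal.ofReal (l * (∑' i, qf ρ (e i)) +
      (∑' i, ν i ^ 2 * qf ρ (e i)) * Real.log Z) := by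
  refine (qEntropy_conj_le ρ h.orthonormal_leftVec fun w hw => h.adjoint_eq_zero hw).trans ?_
  simpa only [h.qf_adjoint_leftVec, Set.indicator_univ] using
    h.clEntropy_indicator_le hρ Set.univ hZ hsum

theorem IsSVD.qEntropy_le_of_sum_le_one (h : IsSVD V e ν) {ρ : E →L[ℂ] E} (hρ : ρ ∈ states E)
    {l : ℝ} (hl : 0 ≤ l) (hsum : ∑' i, ENNReal.ofReal (Real.exp (-(l / ν i ^ 2))) ≤ 1) :
    qEntropy (V ∘L ρ ∘L adjoint V) ≤ ENNReal.ofReal l := by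
  refine (h.qEntropy_le hρ one_pos (by simpa using hsum)).trans (ENNReal.ofReal_le_ofReal ?_)
  rw [Real.log_one, mul_zero, add_zero]
  exact mul_le_of_le_one_right hl (tsum_qf_le_one hρ h.orthonormal)

/-- A bound on the output entropy bounds the partition function of the singular values. -/
theorem IsSVD.tsum_exp_le_one (h : IsSVD V e ν) {S : ℝ} (hS : 0 ≤ S)
    (hb : ∀ ρ ∈ states E, qEntropy (V ∘L ρ ∘L adjoint V) ≤ ENNReal.ofReal S) :
    ∑' i, ENNReal.ofReal (Real.exp (-(S / ν i ^ 2))) ≤ 1 := by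
  rw [ENNReal.tsum_eq_iSup_sum]
  refine iSup_le fun J => ?_
  have h1 := sum_exp_le_one hS hb (e := fun i : J => e i)
    (h.orthonormal.comp _ Subtype.val_injective)
    (fun i j hij => by
      rw [h.inner_apply, h.orthonormal.2 fun hc => hij (Subtype.ext hc), mul_zero])
    (fun i => norm_pos_iff.1 (by rw [h.norm_apply]; exact h.pos i))
  simp only [h.norm_apply] at h1
  rw [Finset.sum_coe_sort J fun i => Real.exp (-(S / ν i ^ 2))] at h1
  rw [← ENNReal.ofReal_sum_of_nonneg fun i _ => (Real.exp_pos _).le]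
  simpa using h1

end SingularValues

/-! ### Continuity of the output entropy -/

section Continuity

set_option linter.unusedSectionVars false

open ContinuousLinearMap (adjoint)

variable {E F ι κ : Type*}
variable [NormedAddCommGroup E] [InnerProductSpace ℂ E] [CompleteSpace E]
variable [NormedAddCommGroup F] [InnerProductSpace ℂ F] [CompleteSpace F]

/-- An orthonormal family can be rotated on a finite set of indices so that the corresponding
corner of a given positive operator becomes diagonal. -/
theorem exists_rotation {f : ι → F} (hf : Orthonormal ℂ f) (J : Finset ι) {A : F →L[ℂ] F}
    (hA : A.IsPositive) :
    ∃ g : ι → F, Orthonormal ℂ g ∧ (∀ i ∉ J, g i = f i) ∧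
      (∀ w, (∀ i, (inner ℂ (g i) w : ℂ) = 0) → ∀ i, (inner ℂ (f i) w : ℂ) = 0) ∧
      ∀ i ∈ J, ∀ j ∈ J, i ≠ j → (inner ℂ (g i) (A (g j)) : ℂ) = 0 := by
  let W : Submodule ℂ F := Submodule.span ℂ (Set.range fun i : J => f i)
  have hfW : ∀ i ∈ J, f i ∈ W := fun i hi => Submodule.subset_span ⟨⟨i, hi⟩, rfl⟩
  have hfd : FiniteDimensional ℂ W := FiniteDimensional.span_of_finite ℂ (Set.finite_range _)
  have hrank : Module.finrank ℂ W = J.card := by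
    have := finrank_span_eq_card
      (hf.comp (fun i : J => (i : ι)) Subtype.val_injective).linearIndependent
    rwa [Fintype.card_coe] at this
  let T : W →ₗ[ℂ] W := (W.orthogonalProjectionOnto ∘L A ∘L W.subtypeL : W →L[ℂ] W)
  have hTinner : ∀ x y : W, (inner ℂ x (T y) : ℂ) = inner ℂ (x : F) (A y) := fun x y => by
    change (inner ℂ x (W.orthogonalProjectionOnto (A y)) : ℂ) = _
    exact Submodule.inner_orthogonalProjectionOnto_eq_of_mem_left x (A y)
  have hT : T.IsSymmetric := fun x y => by
    rw [hTinner, ← inner_conj_symm, hTinner, inner_conj_symm]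
    exact hA.isSymmetric x y
  let b : OrthonormalBasis J ℂ W := (hT.eigenvectorBasis hrank).reindex J.equivFin.symm
  have hb : ∀ i j : J, i ≠ j → (inner ℂ (b i : F) (A (b j : F)) : ℂ) = 0 := by
    intro i j hij
    rw [← hTinner]
    have h1 : T (b j) = ((hT.eigenvalues hrank (J.equivFin j) : ℝ) : ℂ) • b j := by
      simp only [b, OrthonormalBasis.reindex_apply]
      exact hT.apply_eigenvectorBasis hrank _
    rw [h1, inner_smul_right, b.orthonormal.2 hij, mul_zero]
  have hperp : ∀ y ∈ W, ∀ i ∉ J, (inner ℂ y (f i) : ℂ) = 0 := by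
    intro y hy i hi
    induction hy using Submodule.span_induction with
    | mem x hx =>
      obtain ⟨k, rfl⟩ := hx
      exact hf.2 fun h => hi (h ▸ k.2)
    | zero => simp
    | add x y _ _ hx hy => rw [inner_add_left, hx, hy, add_zero]
    | smul c x _ hx => rw [inner_smul_left, hx, mul_zero]
  let g : ι → F := fun i => if h : i ∈ J then (b ⟨i, h⟩ : F) else f i
  have hgJ : ∀ i (h : i ∈ J), g i = b ⟨i, h⟩ := fun i h => dif_pos h
  have hgf : ∀ i ∉ J, g i = f i := fun i h => dif_neg h
  refine ⟨g, ⟨fun i => ?_, fun i j hij => ?_⟩, hgf, fun w hw i => ?_, fun i hi j hj hij => ?_⟩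
  · by_cases hi : i ∈ J
    · rw [hgJ i hi]
      exact b.orthonormal.1 _
    · rw [hgf i hi]
      exact hf.1 i
  · change (inner ℂ (g i) (g j) : ℂ) = 0
    by_cases hi : i ∈ J <;> by_cases hj : j ∈ J
    · rw [hgJ i hi, hgJ j hj]
      exact b.orthonormal.2 fun h => hij (congrArg Subtype.val h)
    · rw [hgJ i hi, hgf j hj]
      exact hperp _ (b _).2 j hj
    · rw [hgf i hi, hgJ j hj, inner_eq_zero_symm]
      exact hperp _ (b _).2 i hi
    · rw [hgf i hi, hgf j hj]
      exact hf.2 hij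
  · by_cases hi : i ∈ J
    · have h1 := congrArg Subtype.val (b.sum_repr' ⟨f i, hfW i hi⟩)
      simp only [Submodule.coe_sum, Submodule.coe_smul] at h1
      rw [← h1, sum_inner]
      refine Finset.sum_eq_zero fun k _ => ?_
      have h2 := hw k
      rw [hgJ k k.2] at h2
      rw [inner_smul_left, h2, mul_zero]
    · rw [← hgf i hi]
      exact hw i
  · rw [hgJ i hi, hgJ j hj]
    exact hb _ _ fun h => hij (congrArg Subtype.val h)

/-- The entropy of a diagonal corner is at most the entropy. -/
theorem clEntropy_corner_le_qEntropy [Fintype κ] {A : F →L[ℂ] F} (hA : A.IsPositive)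
    (hs : ∀ s : Set F, IsONB s → Summable fun v : s => qf A (v : F)) {g : κ → F}
    (hg : Orthonormal ℂ g) (hdiag : ∀ i j, i ≠ j → (inner ℂ (g i) (A (g j)) : ℂ) = 0) :
    clEntropy (fun i => qf A (g i)) ≤ qEntropy A := by
  have hA0 : 0 ≤ A := (ContinuousLinearMap.nonneg_iff_isPositive A).2 hA
  set R : F →L[ℂ] F := CFC.sqrt A with hR
  have hRA : A = R ∘L R := (CFC.sqrt_mul_sqrt_self A hA0).symm
  have hRs : adjoint R = R := (IsSelfAdjoint.of_nonneg (CFC.sqrt_nonneg A)).adjoint_eq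
  have hqf : ∀ x, qf A x = ‖R x‖ ^ 2 := fun x => by
    rw [← qf_adjoint_comp_self, hRs, ← hRA]
  simp only [hqf]
  refine clEntropy_le_qEntropy hs (fun i j hij => ?_) fun x => ?_
  · rw [← ContinuousLinearMap.adjoint_inner_right, hRs]
    have := hdiag i j hij
    rwa [hRA] at this
  · rw [hqf]
    have h1 : ∀ i, ‖(inner ℂ x (R (g i)) : ℂ)‖ = ‖(inner ℂ (g i) (R x) : ℂ)‖ := fun i => by
      rw [← ContinuousLinearMap.adjoint_inner_left, hRs, norm_inner_symm]
    simp only [h1]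
    exact hg.sum_inner_products_le (R x) (s := Finset.univ)

/-- Uniform continuity of the classical entropy of finite families. -/
theorem exists_clEntropy_le_add (κ : Type*) [Fintype κ] (C : ℝ) {ε : ℝ} (hε : 0 < ε) :
    ∃ δ : ℝ, 0 < δ ∧ ∀ x y : κ → ℝ, (∀ i, 0 ≤ x i) → (∀ i, x i ≤ C) → (∀ i, 0 ≤ y i) →
      (∀ i, y i ≤ C) → (∀ i, |x i - y i| ≤ δ) →
      clEntropy x ≤ clEntropy y + ENNReal.ofReal ε := by
  have hc : Continuous fun x : κ → ℝ =>
      ∑ i, Real.negMulLog (x i) - Real.negMulLog (∑ i, x i) := by fun_prop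
  have hu := (isCompact_Icc (a := (0 : κ → ℝ)) (b := fun _ => C)).uniformContinuousOn_of_continuous
    hc.continuousOn
  obtain ⟨δ, hδ, h⟩ := Metric.uniformContinuousOn_iff.1 hu ε hε
  refine ⟨δ / 2, half_pos hδ, fun x y hx hxC hy hyC hxy => ?_⟩
  have h1 := h x ⟨hx, hxC⟩ y ⟨hy, hyC⟩ (lt_of_le_of_lt
    ((dist_pi_le_iff (half_pos hδ).le).2 fun i => by rw [Real.dist_eq]; exact hxy i)
    (half_lt_self hδ))
  rw [Real.dist_eq] at h1
  rw [clEntropy_fintype hx, clEntropy_fintype hy]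
  refine le_trans (ENNReal.ofReal_le_ofReal ?_) ENNReal.ofReal_add_le
  linarith [(abs_lt.1 h1).2]

variable {V : E →L[ℂ] F} {e : ι → E} {ν : ι → ℝ}

/-- If the state is almost concentrated on finitely many singular vectors, the output entropy
is controlled by a finite corner. -/
theorem IsSVD.exists_qEntropy_le_corner (h : IsSVD V e ν) {l : ℝ} (hl : 0 < l)
    (hsum : ∑' i, ENNReal.ofReal (Real.exp (-(l / ν i ^ 2))) ≠ ∞) {ε : ℝ} (hε : 0 < ε) :
    ∃ τ : ℝ, 0 < τ ∧ ∀ ρ ∈ states E, ∀ (J : Finset ι) (g : ι → F), Orthonormal ℂ g →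
      (∀ i ∉ J, g i = leftVec V e ν i) →
      (∀ w, (∀ i, (inner ℂ (g i) w : ℂ) = 0) →
        ∀ i, (inner ℂ (leftVec V e ν i) w : ℂ) = 0) →
      ∑' i, ((J : Set ι)ᶜ).indicator (fun i => qf ρ (e i)) i ≤ τ →
      qEntropy (V ∘L ρ ∘L adjoint V) ≤
        clEntropy (fun i : J => qf ρ (adjoint V (g i))) + ENNReal.ofReal ε := by
  set Z : ℝ := max 1 (∑' i, ENNReal.ofReal (Real.exp (-(l / ν i ^ 2)))).toReal with hZdef
  have hZ1 : 1 ≤ Z := le_max_left _ _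
  have hZ : ∑' i, ENNReal.ofReal (Real.exp (-(l / ν i ^ 2))) ≤ ENNReal.ofReal Z := by
    rw [← ENNReal.ofReal_toReal hsum]
    exact ENNReal.ofReal_le_ofReal (le_max_right _ _)
  set M : ℝ := ‖V‖ ^ 2 + 1 with hM
  have hM1 : 1 ≤ M := by nlinarith [sq_nonneg ‖V‖]
  have hlogZ := Real.log_nonneg hZ1
  have hlogM := Real.log_nonneg hM1
  obtain ⟨δ, hδ, hη⟩ := Metric.continuousAt_iff.1
    (Real.continuous_negMulLog.continuousAt (x := 0)) (ε / 2) (half_pos hε)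
  set K : ℝ := l + M * Real.log Z + M + M * Real.log M with hK
  have hK0 : 0 < K := by positivity
  refine ⟨min (ε / 2 / K) (δ / 2 / M), by positivity, fun ρ hρ J g hg hgf hgker ht => ?_⟩
  set t := ∑' i, ((J : Set ι)ᶜ).indicator (fun i => qf ρ (e i)) i with htdef
  have ht0 : 0 ≤ t := tsum_nonneg fun i => Set.indicator_nonneg (fun i _ => qf_nonneg hρ.1 _) i
  have hind : ((J : Set ι)ᶜ).indicator (fun i => qf ρ (adjoint V (g i))) =
      ((J : Set ι)ᶜ).indicator (fun i => ν i ^ 2 * qf ρ (e i)) := by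
    refine Set.indicator_congr fun i hi => ?_
    rw [hgf i (by simpa using hi), h.qf_adjoint_leftVec]
  set X := ∑' i, ((J : Set ι)ᶜ).indicator (fun i => ν i ^ 2 * qf ρ (e i)) i with hXdef
  have hX0 : 0 ≤ X := tsum_nonneg fun i => Set.indicator_nonneg
    (fun i _ => mul_nonneg (sq_nonneg _) (qf_nonneg hρ.1 _)) i
  have hsmall : Summable fun i => M * ((J : Set ι)ᶜ).indicator (fun i => qf ρ (e i)) i :=
    ((summable_qf hρ h.orthonormal).indicator _).mul_left M
  have hXt : X ≤ M * t := by
    rw [htdef, ← tsum_mul_left]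
    have hle : ∀ i, ((J : Set ι)ᶜ).indicator (fun i => ν i ^ 2 * qf ρ (e i)) i ≤
        M * ((J : Set ι)ᶜ).indicator (fun i => qf ρ (e i)) i := by
      intro i
      by_cases hi : i ∈ ((J : Set ι)ᶜ)
      · simp only [Set.indicator_of_mem hi]
        refine mul_le_mul_of_nonneg_right ?_ (qf_nonneg hρ.1 _)
        have := pow_le_pow_left₀ (h.pos i).le (h.le_norm i) 2
        linarith
      · simp [Set.indicator_of_notMem hi]
    refine Summable.tsum_le_tsum hle (hsmall.of_nonneg_of_le (fun i => ?_) hle) hsmall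
    exact Set.indicator_nonneg (fun i _ => mul_nonneg (sq_nonneg _) (qf_nonneg hρ.1 _)) i
  have ht1 : K * t ≤ ε / 2 := by
    have := ht.trans (min_le_left _ _)
    rwa [le_div_iff₀ hK0, mul_comm] at this
  have ht2 : M * t ≤ δ / 2 := by
    have := ht.trans (min_le_right _ _)
    rwa [le_div_iff₀ (by positivity), mul_comm] at this
  have hηX : Real.negMulLog X ≤ ε / 2 := by
    have h1 : dist X 0 < δ := by
      rw [Real.dist_eq, sub_zero, abs_of_nonneg hX0]
      linarith
    have h2 := hη h1
    rw [Real.dist_eq, Real.negMulLog_zero, sub_zero] at h2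
    exact (le_abs_self _).trans h2.le
  have herr : l * t + X * Real.log Z + (X + (X * Real.log M + Real.negMulLog X)) ≤ ε := by
    have h1 := mul_le_mul_of_nonneg_right hXt hlogZ
    have h2 := mul_le_mul_of_nonneg_right hXt hlogM
    rw [hK] at ht1
    nlinarith
  have hC : ∑' i, qf ρ (adjoint V (g i)) ≤ M :=
    (tsum_qf_adjoint_le hρ hg).trans (by linarith)
  have hsplit := clEntropy_le_split (fun i => qf_nonneg hρ.1 (adjoint V (g i)))
    (summable_qf_adjoint hρ hg) (J : Set ι) hC
  have hcorner : clEntropy ((J : Set ι).indicator fun i => qf ρ (adjoint V (g i))) =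
      clEntropy (fun i : J => qf ρ (adjoint V (g i))) := by
    rw [← clEntropy_comp_of_injective (g := fun i : J => (i : ι)) Subtype.val_injective]
    · congr 1
      ext i
      exact Set.indicator_of_mem i.2 _
    · intro i hi
      exact Set.indicator_of_notMem (fun hc => hi ⟨⟨i, hc⟩, rfl⟩) _
  rw [hind, hcorner, ← hXdef] at hsplit
  have htail := h.clEntropy_indicator_le hρ ((J : Set ι)ᶜ) (one_pos.trans_le hZ1) hZ
  rw [← htdef, ← hXdef] at htail
  have hη1 : 0 ≤ X + (X * Real.log M + Real.negMulLog X) := by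
    have ht3 : t ≤ 1 := le_trans (Summable.tsum_le_tsum
      (fun i => Set.indicator_le_self' (fun i _ => qf_nonneg hρ.1 _) i)
      ((summable_qf hρ h.orthonormal).indicator _) (summable_qf hρ h.orthonormal))
      (tsum_qf_le_one hρ h.orthonormal)
    have hXM : X ≤ M := hXt.trans (mul_le_of_le_one_right (by positivity) ht3)
    rcases hX0.eq_or_lt with hX | hX
    · simp [← hX]
    · have h1 := mul_le_mul_of_nonneg_left (Real.log_le_log hX hXM) hX0
      rw [Real.negMulLog]
      linarith
  calc qEntropy (V ∘L ρ ∘L adjoint V)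
      ≤ clEntropy fun i => qf ρ (adjoint V (g i)) :=
        qEntropy_conj_le ρ hg fun w hw => h.adjoint_eq_zero (hgker w hw)
    _ ≤ _ := hsplit
    _ ≤ clEntropy (fun i : J => qf ρ (adjoint V (g i))) +
        ENNReal.ofReal (l * t + X * Real.log Z) +
        ENNReal.ofReal (X + (X * Real.log M + Real.negMulLog X)) := by gcongr
    _ = clEntropy (fun i : J => qf ρ (adjoint V (g i))) +
        ENNReal.ofReal (l * t + X * Real.log Z +
          (X + (X * Real.log M + Real.negMulLog X))) := by
        rw [add_assoc, ENNReal.ofReal_add (by positivity) hη1]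
    _ ≤ _ := by gcongr

/-- Continuity of the output entropy. -/
theorem IsSVD.contOn (h : IsSVD V e ν) {l : ℝ} (hl : 0 < l)
    (hsum : ∑' i, ENNReal.ofReal (Real.exp (-(l / ν i ^ 2))) ≠ ∞) :
    ContOn (fun ρ => qEntropy (V ∘L ρ ∘L adjoint V)) (states E) := by
  have hfin : ∀ ρ ∈ states E, qEntropy (V ∘L ρ ∘L adjoint V) ≠ ∞ := fun ρ hρ =>
    ne_top_of_le_ne_top ENNReal.ofReal_ne_top (h.qEntropy_le hρ (l := l)
      (lt_max_of_lt_left (c := (∑' i, ENNReal.ofReal (Real.exp (-(l / ν i ^ 2)))).toReal) one_pos)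
      ((ENNReal.ofReal_toReal hsum).ge.trans (ENNReal.ofReal_le_ofReal (le_max_right _ _))))
  refine ⟨hfin, fun ρ₀ hρ₀ ε hε => ?_⟩
  obtain ⟨τ, hτ, hcorner⟩ := h.exists_qEntropy_le_corner hl hsum (ε := ε / 4) (by positivity)
  have hp0 := summable_qf hρ₀ h.orthonormal
  obtain ⟨J, hJ⟩ : ∃ J : Finset ι,
      ∑' i, ((J : Set ι)ᶜ).indicator (fun i => qf ρ₀ (e i)) i ≤ τ / 2 := by
    obtain ⟨J, hJ⟩ := ((tendsto_order.1 (tendsto_tsum_compl_atTop_zero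
      fun i => qf ρ₀ (e i))).2 (τ / 2) (half_pos hτ)).exists
    refine ⟨J, ?_⟩
    rw [← tsum_subtype]
    exact hJ.le
  obtain ⟨δ, hδ, hunif⟩ := exists_clEntropy_le_add J (‖V‖ ^ 2) (ε := ε / 4) (by positivity)
  have hM : 0 < ‖V‖ ^ 2 + 1 := by positivity
  refine ⟨min (τ / 2) (δ / (‖V‖ ^ 2 + 1)), by positivity, fun ρ hρ hclose => ?_⟩
  set d := min (τ / 2) (δ / (‖V‖ ^ 2 + 1)) with hd
  have hd1 : d ≤ τ / 2 := min_le_left _ _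
  have hd2 : d * ‖V‖ ^ 2 ≤ δ := by
    have h1 : d * (‖V‖ ^ 2 + 1) ≤ δ := (le_div_iff₀ hM).1 (min_le_right _ _)
    have h2 : 0 ≤ d := by positivity
    linarith
  have hJρ : ∑' i, ((J : Set ι)ᶜ).indicator (fun i => qf ρ (e i)) i ≤ τ := by
    refine ((summable_qf hρ h.orthonormal).indicator _).tsum_le_of_sum_le fun s => ?_
    calc ∑ i ∈ s, ((J : Set ι)ᶜ).indicator (fun i => qf ρ (e i)) i
        ≤ ∑ i ∈ s, (((J : Set ι)ᶜ).indicator (fun i => qf ρ₀ (e i)) i + |qf (ρ - ρ₀) (e i)|) := by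
          refine Finset.sum_le_sum fun i _ => ?_
          by_cases hi : i ∈ ((J : Set ι)ᶜ)
          · simp only [Set.indicator_of_mem hi]
            have := le_abs_self (qf (ρ - ρ₀) (e i))
            rw [qf_sub] at this ⊢
            linarith
          · simp [Set.indicator_of_notMem hi]
      _ ≤ τ / 2 + d := by
          rw [Finset.sum_add_distrib]
          refine add_le_add (le_trans ?_ hJ) (abs_qf_le_traceNorm hclose h.orthonormal s)
          exact (hp0.indicator _).sum_le_tsum s fun i _ =>
            Set.indicator_nonneg (fun i _ => qf_nonneg hρ₀.1 _) i
      _ ≤ τ := by linarith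
  have hnorm : ∀ {g : ι → F}, Orthonormal ℂ g → ∀ i, ‖adjoint V (g i)‖ ^ 2 ≤ ‖V‖ ^ 2 := by
    intro g hg i
    have h1 := (adjoint V).unit_le_opNorm _ (hg.1 i).le
    rw [LinearIsometryEquiv.norm_map] at h1
    exact pow_le_pow_left₀ (norm_nonneg _) h1 2
  have hdiff : ∀ {g : ι → F}, Orthonormal ℂ g → ∀ i,
      |qf ρ (adjoint V (g i)) - qf ρ₀ (adjoint V (g i))| ≤ δ := by
    intro g hg i
    rw [← qf_sub]
    refine (abs_qf_le hclose _).trans (le_trans ?_ hd2)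
    exact mul_le_mul_of_nonneg_left (hnorm hg i) (by positivity)
  have key : ∀ σ ∈ states E, ∀ ω ∈ states E,
      ∑' i, ((J : Set ι)ᶜ).indicator (fun i => qf σ (e i)) i ≤ τ →
      (∀ {g : ι → F}, Orthonormal ℂ g → ∀ i,
        |qf σ (adjoint V (g i)) - qf ω (adjoint V (g i))| ≤ δ) →
      (qEntropy (V ∘L σ ∘L adjoint V)).toReal ≤
        (qEntropy (V ∘L ω ∘L adjoint V)).toReal + ε / 2 := by
    intro σ hσ ω hω htail hclose
    have hA : (V ∘L ω ∘L adjoint V).IsPositive := hω.1.conj_adjoint V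
    obtain ⟨g, hg, hgf, hgker, hgdiag⟩ := exists_rotation h.orthonormal_leftVec J hA
    have h1 := hcorner σ hσ J g hg hgf hgker htail
    have h2 := hunif (fun i => qf σ (adjoint V (g i))) (fun i => qf ω (adjoint V (g i)))
      (fun i => qf_nonneg hσ.1 _) (fun i => (qf_le_norm_sq hσ _).trans (hnorm hg i))
      (fun i => qf_nonneg hω.1 _) (fun i => (qf_le_norm_sq hω _).trans (hnorm hg i))
      fun i => hclose hg i
    have h3 := clEntropy_corner_le_qEntropy hA (fun s hs => summable_qf_conj hω V hs)
      (g := fun i : J => g i) (hg.comp _ Subtype.val_injective)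
      fun i j hij => hgdiag i i.2 j j.2 fun hc => hij (Subtype.ext hc)
    simp only [qf_conj] at h3
    have h4 : qEntropy (V ∘L σ ∘L adjoint V) ≤
        qEntropy (V ∘L ω ∘L adjoint V) + ENNReal.ofReal (ε / 2) := by
      refine h1.trans ((add_le_add_left (h2.trans (add_le_add_left h3 _)) _).trans_eq ?_)
      rw [add_assoc, ← ENNReal.ofReal_add (by positivity) (by positivity)]
      congr 2
      ring
    have h5 := ENNReal.toReal_mono (ENNReal.add_ne_top.2 ⟨hfin ω hω, ENNReal.ofReal_ne_top⟩) h4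
    rwa [ENNReal.toReal_add (hfin ω hω) ENNReal.ofReal_ne_top,
      ENNReal.toReal_ofReal (by positivity)] at h5
  have k1 := key ρ hρ ρ₀ hρ₀ hJρ hdiff
  have k2 := key ρ₀ hρ₀ ρ hρ (hJ.trans (half_le_self hτ.le)) fun hg i => by
    rw [abs_sub_comm]
    exact hdiff hg i
  rw [abs_lt]
  constructor <;> linarith

end Continuity

/-! ### Partition functions of the singular values -/

section PartitionFunction

variable {ν : ℕ → ℝ} {l l' : ℝ}

theorem expSum_eq_tsum_subtype (ν : ℕ → ℝ) (l : ℝ) :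
    expSum ν l = ∑' i : {i // ν i ≠ 0}, ENNReal.ofReal (Real.exp (-(l / ν i ^ 2))) := by
  refine Eq.trans (tsum_congr fun i => ?_) (tsum_subtype {i | ν i ≠ 0}
    fun i => ENNReal.ofReal (Real.exp (-(l / ν i ^ 2)))).symm
  by_cases hi : ν i = 0 <;> simp [hi, Set.indicator]

theorem expSum_anti (ν : ℕ → ℝ) (h : l ≤ l') : expSum ν l' ≤ expSum ν l := by
  rw [expSum_eq_tsum_subtype, expSum_eq_tsum_subtype]
  refine ENNReal.tsum_le_tsum fun i => ENNReal.ofReal_le_ofReal ?_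
  gcongr

theorem expSum_lt (h : l < l') (htop : expSum ν l' ≠ ∞) (h0 : expSum ν l' ≠ 0) :
    expSum ν l' < expSum ν l := by
  rw [expSum_eq_tsum_subtype] at htop h0 ⊢
  rw [expSum_eq_tsum_subtype ν l]
  obtain ⟨i, -⟩ : ∃ i : {i // ν i ≠ 0},
      ENNReal.ofReal (Real.exp (-(l' / ν i ^ 2))) ≠ 0 := by
    by_contra! hcon
    exact h0 (ENNReal.tsum_eq_zero.2 hcon)
  have hpos : ∀ i : {i // ν i ≠ 0}, 0 < ν i ^ 2 := fun i => by have := i.2; positivity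
  refine ENNReal.tsum_lt_tsum (i := i) htop (fun j => ENNReal.ofReal_le_ofReal ?_)
    ((ENNReal.ofReal_lt_ofReal_iff (Real.exp_pos _)).2 ?_)
  · gcongr
  · have := hpos i
    gcongr

theorem nonneg_of_expSum_eq_one (h : expSum ν l = 1) : 0 ≤ l := by
  by_contra! hl
  rw [expSum_eq_tsum_subtype] at h
  obtain ⟨i⟩ : Nonempty {i // ν i ≠ 0} := by
    by_contra hc
    rw [not_nonempty_iff] at hc
    simp at h
  have h1 := (ENNReal.le_tsum i).trans_eq h
  rw [ENNReal.ofReal_le_one, Real.exp_le_one_iff, neg_nonpos] at h1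
  have h2 : l / ν i ^ 2 < 0 := div_neg_of_neg_of_pos hl (by have := i.2; positivity)
  linarith

/-- The intermediate value theorem for the partition function. -/
theorem exists_expSum_eq_one (hll : l ≤ l') (htop : expSum ν l ≠ ∞) (h1 : 1 ≤ expSum ν l)
    (h1' : expSum ν l' ≤ 1) : ∃ x, expSum ν x = 1 := by
  let f : ℝ → ℝ := fun x => ∑' i : {i // ν i ≠ 0}, Real.exp (-(x / ν i ^ 2))
  have hs : Summable fun i : {i // ν i ≠ 0} => Real.exp (-(l / ν i ^ 2)) := by
    rw [expSum_eq_tsum_subtype] at htop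
    simpa only [ENNReal.toReal_ofReal (Real.exp_pos _).le] using ENNReal.summable_toReal htop
  have hle : ∀ x, l ≤ x → ∀ i : {i // ν i ≠ 0},
      Real.exp (-(x / ν i ^ 2)) ≤ Real.exp (-(l / ν i ^ 2)) := by
    intro x hx i
    gcongr
  have hf : ∀ x, l ≤ x → expSum ν x = ENNReal.ofReal (f x) := by
    intro x hx
    rw [expSum_eq_tsum_subtype, ENNReal.ofReal_tsum_of_nonneg fun i => (Real.exp_pos _).le]
    exact hs.of_nonneg_of_le (fun i => (Real.exp_pos _).le) (hle x hx)
  have hc : ContinuousOn f (Set.Icc l l') :=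
    continuousOn_tsum (fun i => by fun_prop) hs fun i x hx => by
      rw [Real.norm_of_nonneg (Real.exp_pos _).le]
      exact hle x hx.1 i
  rw [hf l le_rfl, ENNReal.one_le_ofReal] at h1
  rw [hf l' hll, ENNReal.ofReal_le_one] at h1'
  obtain ⟨x, hx, hfx⟩ := intermediate_value_Icc' hll hc ⟨h1', h1⟩
  exact ⟨x, by rw [hf x hx.1, hfx, ENNReal.ofReal_one]⟩

end PartitionFunction

/-- Proposition 2 of the paper. For a bounded operator
`V : ℋ → ℋ'`, the function `ρ ↦ H(VρV*)` is continuous on `𝔖(ℋ)` iff `V` is compact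
with singular values `{νᵢ}` satisfying `∑ᵢ e^{−λ/νᵢ²} < ∞` for some `λ > 0`; in that
case `sup_ρ H(VρV*) = λ*(V)`, the unique solution of `∑ᵢ e^{−λ/νᵢ²} = 1` when it
exists and `inf{λ > 0 | ∑ᵢ e^{−λ/νᵢ²} < ∞}` otherwise. -/
theorem statement6
    {E F : Type*}
    [NormedAddCommGroup E] [InnerProductSpace ℂ E] [CompleteSpace E]
    [TopologicalSpace.SeparableSpace E]
    [NormedAddCommGroup F] [InnerProductSpace ℂ F] [CompleteSpace F]
    [TopologicalSpace.SeparableSpace F]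
    (V : E →L[ℂ] F) :
    (ContOn (fun ρ => qEntropy (V ∘L ρ ∘L ContinuousLinearMap.adjoint V)) (states E) ↔
      IsCompactOperator ⇑V ∧ LamStarFin V) ∧
    (ContOn (fun ρ => qEntropy (V ∘L ρ ∘L ContinuousLinearMap.adjoint V)) (states E) →
      ∀ ν : ℕ → ℝ, IsSingularValues V ν →
        ((∀ l : ℝ, expSum ν l = 1 →
            (⨆ ρ ∈ states E, qEntropy (V ∘L ρ ∘L ContinuousLinearMap.adjoint V)) =
              ENNReal.ofReal l) ∧
         ((¬ ∃ l : ℝ, expSum ν l = 1) →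
            (⨆ ρ ∈ states E, qEntropy (V ∘L ρ ∘L ContinuousLinearMap.adjoint V)) =
              ⨅ (l : ℝ) (_ : 0 < l ∧ expSum ν l ≠ ∞), ENNReal.ofReal l))) := by

  have hlam : ∀ ν : ℕ → ℝ, IsSingularValues V ν →
      ∀ S : ℝ, 0 ≤ S → (∀ ρ ∈ states E,
        qEntropy (V ∘L ρ ∘L ContinuousLinearMap.adjoint V) ≤ ENNReal.ofReal S) →
      expSum ν S ≤ 1 := by
    intro ν hν S hS hb
    obtain ⟨e, he⟩ := hν.exists_isSVD
    rw [expSum_eq_tsum_subtype]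
    exact he.tsum_exp_le_one hS hb
  refine ⟨⟨fun hcont => ?_, fun ⟨_, ν, hν, l, hl, hsum⟩ => ?_⟩, fun hcont ν hν => ?_⟩
  · obtain ⟨S, hS, hb⟩ := exists_bound_of_forall_ne_top hcont.1
    have hV := isCompactOperator_of_bound hS hb
    obtain ⟨ν, hν⟩ := exists_isSingularValues hV
    exact ⟨hV, ν, hν, S + 1, by positivity, ne_top_of_le_ne_top ENNReal.one_ne_top
      ((expSum_anti ν (by linarith)).trans (hlam ν hν S hS hb))⟩
  · obtain ⟨e, he⟩ := hν.exists_isSVD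
    rw [expSum_eq_tsum_subtype] at hsum
    exact he.contOn hl hsum
  · obtain ⟨S', hS', hb'⟩ := exists_bound_of_forall_ne_top hcont.1
    set s := ⨆ ρ ∈ states E, qEntropy (V ∘L ρ ∘L ContinuousLinearMap.adjoint V) with hs
    have hsfin : s ≠ ∞ := ne_top_of_le_ne_top ENNReal.ofReal_ne_top (iSup₂_le hb')
    set S := s.toReal with hSdef
    have hS : 0 ≤ S := ENNReal.toReal_nonneg
    have hsS : s = ENNReal.ofReal S := (ENNReal.ofReal_toReal hsfin).symm
    have hS1 : expSum ν S ≤ 1 := hlam ν hν S hS fun ρ hρ => hsS ▸ le_iSup₂_of_le ρ hρ le_rfl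
    have hup : ∀ l, 0 ≤ l → expSum ν l ≤ 1 → S ≤ l := by
      intro l hl hsum
      obtain ⟨e, he⟩ := hν.exists_isSVD
      rw [expSum_eq_tsum_subtype] at hsum
      refine (ENNReal.ofReal_le_ofReal_iff hl).1 (hsS ▸ iSup₂_le fun ρ hρ => ?_)
      exact he.qEntropy_le_of_sum_le_one hρ hl hsum
    refine ⟨fun l hl => ?_, fun hno => ?_⟩
    · have hSl := hup l (nonneg_of_expSum_eq_one hl) hl.le
      rcases hSl.eq_or_lt with h | h
      · rw [hsS, h]
      · have := expSum_lt (ν := ν) h (by simp [hl]) (by simp [hl])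
        exact absurd (hl ▸ this) hS1.not_gt
    · rw [hsS]
      refine le_antisymm (le_iInf₂ fun l hl => ENNReal.ofReal_le_ofReal ?_) ?_
      · by_contra! hlS
        rcases le_total (expSum ν l) 1 with h | h
        · exact hlS.not_ge (hup l hl.1.le h)
        · exact hno (exists_expSum_eq_one hlS.le hl.2 h hS1)
      · refine ENNReal.le_of_forall_pos_le_add fun ε hε _ => ?_
        refine (iInf₂_le (S + ε) ⟨by positivity, ne_top_of_le_ne_top ENNReal.one_ne_top
          ((expSum_anti ν (by simp)).trans hS1)⟩).trans ?_
        exact ENNReal.ofReal_add_le.trans_eq (by rw [ENNReal.ofReal_coe_nnreal])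

end QIT
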